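/- arXiv:1005.4987 — 2 statements merged into one kernel-verified Lean document; each statement's English description precedes it below -/
import Mathlib

section
/- Let X1 be a tight spherical 4-design on the unit sphere S^21 in ℝ^22, i.e., a spherical 4-design with |X1| = 275. Then the set { y ∈ S^21 : for all x ∈ X1, x·y ∈ {1/√11, −1/(4√11), −3/(2√11)} } has exactly 4050 elements. -/
open MeasureTheory Metric MvPolynomial
open scoped RealInnerProductSpace Classical

/-- Average of a polynomial over the sphere of radius `r` centered at the origin in `ℝⁿ`,
with respect to the (rotation-invariant, normalized) surface measure. -/
noncomputable def sphereAvg (n : ℕ) (r : ℝ) (f : MvPolynomial (Fin n) ℝ) : ℝ :=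
  ⨍ u : sphere (0 : EuclideanSpace ℝ (Fin n)) 1,
    eval (fun i => r * (u : EuclideanSpace ℝ (Fin n)) i) f
    ∂((volume : Measure (EuclideanSpace ℝ (Fin n))).toSphere)

/-- The surface measure on the unit sphere of an inner product space. -/
noncomputable abbrev surfaceMeasure (n : ℕ) : Measure (sphere (0 : EuclideanSpace ℝ (Fin n)) 1) :=
  (volume : Measure (EuclideanSpace ℝ (Fin n))).toSphere

/-- The homeomorphism of the unit sphere induced by a linear isometry. -/
noncomputable def sphereHomeo {n : ℕ}
    (φ : EuclideanSpace ℝ (Fin n) ≃ₗᵢ[ℝ] EuclideanSpace ℝ (Fin n)) :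
    sphere (0 : EuclideanSpace ℝ (Fin n)) 1 ≃ₜ sphere (0 : EuclideanSpace ℝ (Fin n)) 1 :=
  φ.toHomeomorph.subtype (fun x => by simp)

open scoped Pointwise in
lemma measurePreserving_sphereHomeo {n : ℕ}
    (φ : EuclideanSpace ℝ (Fin n) ≃ₗᵢ[ℝ] EuclideanSpace ℝ (Fin n)) :
    MeasurePreserving (sphereHomeo φ) (surfaceMeasure n) (surfaceMeasure n) := by
  refine ⟨(sphereHomeo φ).measurable, ?_⟩
  ext s hs
  rw [Measure.map_apply (sphereHomeo φ).measurable hs, Measure.toSphere_apply' _ hs,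
    Measure.toSphere_apply' _ ((sphereHomeo φ).measurable hs)]
  have hset : Set.Ioo (0 : ℝ) 1 • (Subtype.val '' (sphereHomeo φ ⁻¹' s)) =
      φ ⁻¹' (Set.Ioo (0 : ℝ) 1 • (Subtype.val '' s)) := by
    ext x
    simp only [Set.mem_smul, Set.mem_image, Set.mem_preimage]
    constructor
    · rintro ⟨r, hr, y, ⟨z, hz, rfl⟩, rfl⟩
      exact ⟨r, hr, φ z, ⟨sphereHomeo φ z, hz, rfl⟩, (φ.map_smul r z).symm⟩
    · rintro ⟨r, hr, y, ⟨z, hz, rfl⟩, h⟩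
      refine ⟨r, hr, φ.symm z, ⟨(sphereHomeo φ).symm z, by simpa using hz, rfl⟩, ?_⟩
      rw [← φ.symm.map_smul, h, φ.symm_apply_apply]
  rw [hset, φ.measurePreserving.measure_preimage_emb φ.toHomeomorph.measurableEmbedding]

/-- Average over the unit sphere of the `k`-th power of a linear form. -/
noncomputable def sphereMoment (n k : ℕ) (a : EuclideanSpace ℝ (Fin n)) : ℝ :=
  ⨍ u : sphere (0 : EuclideanSpace ℝ (Fin n)) 1, ⟪(u : EuclideanSpace ℝ (Fin n)), a⟫ ^ k
    ∂(surfaceMeasure n)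

lemma sphereMoment_map {n : ℕ} (k : ℕ)
    (φ : EuclideanSpace ℝ (Fin n) ≃ₗᵢ[ℝ] EuclideanSpace ℝ (Fin n))
    (a : EuclideanSpace ℝ (Fin n)) : sphereMoment n k (φ a) = sphereMoment n k a := by
  unfold sphereMoment
  rw [average_eq, average_eq]
  congr 1
  rw [← (measurePreserving_sphereHomeo φ).integral_comp (sphereHomeo φ).measurableEmbedding]
  refine integral_congr_ae (Filter.Eventually.of_forall fun u => ?_)
  change ⟪φ (u : EuclideanSpace ℝ (Fin n)), φ a⟫ ^ k = _
  rw [φ.inner_map_map]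

lemma sphereMoment_eq_of_norm_eq {n : ℕ} (k : ℕ) {a b : EuclideanSpace ℝ (Fin n)}
    (h : ‖a‖ = ‖b‖) : sphereMoment n k a = sphereMoment n k b := by
  rw [← Submodule.reflection_sub h, sphereMoment_map]

lemma sphereMoment_smul {n : ℕ} (k : ℕ) (c : ℝ) (a : EuclideanSpace ℝ (Fin n)) :
    sphereMoment n k (c • a) = c ^ k * sphereMoment n k a := by
  unfold sphereMoment
  rw [average_eq, average_eq]
  simp_rw [inner_smul_right, mul_pow, integral_const_mul, smul_eq_mul]
  ring

lemma sphereMoment_odd {n k : ℕ} (hk : Odd k) (a : EuclideanSpace ℝ (Fin n)) :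
    sphereMoment n k a = 0 := by
  have h := sphereMoment_smul k (-1) a
  rw [sphereMoment_eq_of_norm_eq k (b := a) (by simp), hk.neg_one_pow] at h
  linarith

lemma integrable_surfaceMeasure {n : ℕ} {f : sphere (0 : EuclideanSpace ℝ (Fin n)) 1 → ℝ}
    (hf : Continuous f) : Integrable f (surfaceMeasure n) :=
  (BoundedContinuousFunction.mkOfCompact ⟨f, hf⟩).integrable _

lemma sphereMoment_eq_norm_pow_mul {n : ℕ} (k : ℕ) (i : Fin n) (a : EuclideanSpace ℝ (Fin n)) :
    sphereMoment n k a = ‖a‖ ^ k * sphereMoment n k (EuclideanSpace.single i 1) := by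
  rw [← sphereMoment_smul]
  exact sphereMoment_eq_of_norm_eq k (by simp [norm_smul])

lemma sum_coord_sq {n : ℕ} (u : sphere (0 : EuclideanSpace ℝ (Fin n)) 1) :
    ∑ i, (u : EuclideanSpace ℝ (Fin n)) i ^ 2 = 1 := by
  have h : ‖(u : EuclideanSpace ℝ (Fin n))‖ ^ 2 = 1 := by simp
  rwa [EuclideanSpace.norm_sq_eq, Finset.sum_congr rfl (fun i _ => by rw [Real.norm_eq_abs, sq_abs])] at h

lemma sphereMoment_two {n : ℕ} (hn : 0 < n) (a : EuclideanSpace ℝ (Fin n)) :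
    sphereMoment n 2 a = ‖a‖ ^ 2 / n := by
  have : Nonempty (Fin n) := ⟨⟨0, hn⟩⟩
  have hne : (surfaceMeasure n) ≠ 0 := Measure.toSphere_ne_zero _
  have : NeZero (surfaceMeasure n) := ⟨hne⟩
  have key : ∑ i : Fin n, sphereMoment n 2 (EuclideanSpace.single i 1) = 1 := by
    unfold sphereMoment
    simp_rw [average_eq, smul_eq_mul]
    rw [← Finset.mul_sum, ← integral_finsetSum _
      (fun i _ => integrable_surfaceMeasure (by fun_prop)), ← smul_eq_mul, ← average_eq]
    simp [EuclideanSpace.inner_single_right, sum_coord_sq]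
  have h0 : ∀ i : Fin n, sphereMoment n 2 (EuclideanSpace.single i 1)
      = sphereMoment n 2 (EuclideanSpace.single ⟨0, hn⟩ 1) := fun i =>
    sphereMoment_eq_of_norm_eq 2 (by simp)
  simp_rw [h0] at key
  rw [sphereMoment_eq_norm_pow_mul 2 ⟨0, hn⟩ a]
  simp only [Finset.sum_const, Finset.card_univ, Fintype.card_fin, nsmul_eq_mul] at key
  have : (n : ℝ) ≠ 0 := by positivity
  field_simp
  linear_combination ‖a‖ ^ 2 * key

lemma sphereMoment_four {n : ℕ} (hn : 0 < n) (a : EuclideanSpace ℝ (Fin n)) :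
    sphereMoment n 4 a = 3 * ‖a‖ ^ 4 / (n * (n + 2)) := by
  have : Nonempty (Fin n) := ⟨⟨0, hn⟩⟩
  have hne : (surfaceMeasure n) ≠ 0 := Measure.toSphere_ne_zero _
  have : NeZero (surfaceMeasure n) := ⟨hne⟩
  set m := sphereMoment n 4 (EuclideanSpace.single (⟨0, hn⟩ : Fin n) 1) with hm
  have hnorm : ∀ b : EuclideanSpace ℝ (Fin n), sphereMoment n 4 b = ‖b‖ ^ 4 * m :=
    fun b => sphereMoment_eq_norm_pow_mul 4 ⟨0, hn⟩ b
  let M : Fin n → Fin n → ℝ := fun i j =>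
    ⨍ u : sphere (0 : EuclideanSpace ℝ (Fin n)) 1, (u : EuclideanSpace ℝ (Fin n)) i ^ 2 *
      (u : EuclideanSpace ℝ (Fin n)) j ^ 2 ∂(surfaceMeasure n)
  have hdiag : ∀ i, M i i = m := by
    intro i
    rw [hm, ← sphereMoment_eq_of_norm_eq 4 (a := EuclideanSpace.single i 1) (by simp)]
    simp only [M, sphereMoment, EuclideanSpace.inner_single_right]
    congr 1
    ext u
    simp
    ring
  have hoff : ∀ i j, i ≠ j → M i j = m / 3 := by
    intro i j hij
    have hadd : ∀ s : ℝ, s ^ 2 = 1 →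
        ‖EuclideanSpace.single i (1 : ℝ) + s • EuclideanSpace.single j (1 : ℝ)‖ ^ 4 = 4 := by
      intro s hs
      have : ‖EuclideanSpace.single i (1 : ℝ) + s • EuclideanSpace.single j (1 : ℝ)‖ ^ 2 = 2 := by
        rw [norm_add_sq_real, norm_smul, inner_smul_right, EuclideanSpace.inner_single_left]
        simp [hij]
        linarith
      nlinarith
    have h1 := hnorm (EuclideanSpace.single i (1 : ℝ) + (1 : ℝ) • EuclideanSpace.single j (1 : ℝ))
    have h2 := hnorm (EuclideanSpace.single i (1 : ℝ) + (-1 : ℝ) • EuclideanSpace.single j (1 : ℝ))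
    rw [hadd _ (by norm_num)] at h1 h2
    have h3 : sphereMoment n 4 (EuclideanSpace.single i (1 : ℝ) + (1 : ℝ) • EuclideanSpace.single j (1 : ℝ))
       + sphereMoment n 4 (EuclideanSpace.single i (1 : ℝ) + (-1 : ℝ) • EuclideanSpace.single j (1 : ℝ))
       = 2 * M i i + 2 * M j j + 12 * M i j := by
      simp only [M, sphereMoment, average_eq, smul_eq_mul]
      rw [← mul_add, mul_left_comm 2, mul_left_comm 2,
        mul_left_comm 12, ← mul_add, ← mul_add]
      congr 1
      rw [← integral_const_mul, ← integral_const_mul,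
        ← integral_const_mul, ← integral_add (integrable_surfaceMeasure (by fun_prop))
        (integrable_surfaceMeasure (by fun_prop)), ← integral_add (integrable_surfaceMeasure (by fun_prop))
        (integrable_surfaceMeasure (by fun_prop)), ← integral_add
        (integrable_surfaceMeasure (by fun_prop)) (integrable_surfaceMeasure (by fun_prop))]
      congr 1
      ext u
      simp [inner_add_right, EuclideanSpace.inner_single_right]
      ring
    rw [hdiag, hdiag] at h3
    linarith
  have key : ∑ i, ∑ j, M i j = 1 := by
    simp only [M, average_eq, smul_eq_mul]
    simp_rw [← Finset.mul_sum]
    rw [Finset.sum_congr rfl (fun i _ => (integral_finsetSum _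
      (fun j _ => integrable_surfaceMeasure (by fun_prop))).symm), ← integral_finsetSum _
      (fun i _ => integrable_surfaceMeasure (by fun_prop)), ← smul_eq_mul, ← average_eq]
    simp_rw [← Finset.mul_sum, sum_coord_sq, mul_one, sum_coord_sq]
    simp
  have hrow : ∀ i, ∑ j, M i j = m + (n - 1) * (m / 3) := by
    intro i
    rw [← Finset.add_sum_erase _ _ (Finset.mem_univ i), hdiag,
      Finset.sum_congr rfl (fun j hj => hoff i j (Finset.ne_of_mem_erase hj).symm)]
    simp [Finset.card_erase_of_mem, Nat.cast_sub (show 1 ≤ n from hn)]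
  simp_rw [hrow] at key
  rw [hnorm]
  simp only [Finset.sum_const, Finset.card_univ, Fintype.card_fin, nsmul_eq_mul] at key
  have : (n : ℝ) ≠ 0 := by positivity
  field_simp
  linear_combination 3 * ‖a‖ ^ 4 * key

lemma sum_inner_pow_of_design {n t : ℕ} {Y : Finset (EuclideanSpace ℝ (Fin n))}
    (hY : 0 < Y.card)
    (hdesign : ∀ f : MvPolynomial (Fin n) ℝ, f.totalDegree ≤ t →
      sphereAvg n 1 f = (Y.card : ℝ)⁻¹ * ∑ x ∈ Y, eval (x : Fin n → ℝ) f)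
    {k : ℕ} (hk : k ≤ t) (a : EuclideanSpace ℝ (Fin n)) :
    ∑ x ∈ Y, ⟪x, a⟫ ^ k = Y.card * sphereMoment n k a := by
  have hev : ∀ v : EuclideanSpace ℝ (Fin n),
      eval (v : Fin n → ℝ) ((∑ i, C (a i) * X i) ^ k) = ⟪v, a⟫ ^ k := by
    intro v
    simp [PiLp.inner_apply]
  have h := hdesign ((∑ i, C (a i) * X i) ^ k) <| by
    refine (totalDegree_pow _ _).trans ?_
    refine (Nat.mul_le_mul_left k (?_ : _ ≤ 1)).trans (by simpa using hk)
    refine totalDegree_finsetSum_le fun i _ => ?_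
    refine (totalDegree_mul _ _).trans ?_
    simp
  simp_rw [hev] at h
  have h' : sphereAvg n 1 ((∑ i, C (a i) * X i) ^ k) = sphereMoment n k a := by
    unfold sphereAvg sphereMoment
    simp_rw [one_mul]
    congr 1
    ext u
    exact hev u
  rw [← h', h]
  field_simp

section Design

variable {E : Type*} [NormedAddCommGroup E] [InnerProductSpace ℝ E]

/-- A tight spherical 4-design in dimension 22, scaled so that its points have squared norm 12
and all its inner products are integers, recorded through its polarized moments. -/
structure IsScaledTightDesign (X : Finset E) : Prop where
  card_eq : X.card = 275
  inner_self : ∀ x ∈ X, ⟪x, x⟫ = 12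
  inner_eq : ∀ x ∈ X, ∀ y ∈ X, x ≠ y → ⟪x, y⟫ = 2 ∨ ⟪x, y⟫ = -3
  sum_one : ∀ a, ∑ x ∈ X, ⟪x, a⟫ = 0
  sum_two : ∀ a b, ∑ x ∈ X, ⟪x, a⟫ * ⟪x, b⟫ = 150 * ⟪a, b⟫
  sum_three : ∀ a b c, ∑ x ∈ X, ⟪x, a⟫ * ⟪x, b⟫ * ⟪x, c⟫ = 0
  sum_four : ∀ a b c d, ∑ x ∈ X, ⟪x, a⟫ * ⟪x, b⟫ * ⟪x, c⟫ * ⟪x, d⟫ =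
    75 * (⟪a, b⟫ * ⟪c, d⟫ + ⟪a, c⟫ * ⟪b, d⟫ + ⟪a, d⟫ * ⟪b, c⟫)

lemma isScaledTightDesign_of_powers {X : Finset E} (hcard : X.card = 275)
    (hnorm : ∀ x ∈ X, ⟪x, x⟫ = 12) (h1 : ∀ a, ∑ x ∈ X, ⟪x, a⟫ ^ 1 = 0)
    (h2 : ∀ a, ∑ x ∈ X, ⟪x, a⟫ ^ 2 = 150 * ⟪a, a⟫) (h3 : ∀ a, ∑ x ∈ X, ⟪x, a⟫ ^ 3 = 0)
    (h4 : ∀ a, ∑ x ∈ X, ⟪x, a⟫ ^ 4 = 225 * ⟪a, a⟫ ^ 2) : IsScaledTightDesign X where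
  card_eq := hcard
  inner_self := hnorm
  inner_eq := by
    intro x hx y hy hxy
    have hsum : ∑ z ∈ X, ((⟪z, y⟫ - 2) * (⟪z, y⟫ + 3)) ^ 2 = 22500 := by
      have : ∀ z, ((⟪z, y⟫ - 2) * (⟪z, y⟫ + 3)) ^ 2 = ⟪z, y⟫ ^ 4 + 2 * ⟪z, y⟫ ^ 3
          - 11 * ⟪z, y⟫ ^ 2 - 12 * ⟪z, y⟫ ^ 1 + 36 := fun z => by ring
      simp_rw [this, Finset.sum_add_distrib, Finset.sum_sub_distrib, Finset.sum_add_distrib,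
        ← Finset.mul_sum, h1, h2, h3, h4, hnorm y hy, Finset.sum_const, hcard]
      norm_num
    rw [← Finset.add_sum_erase _ _ hy, hnorm y hy] at hsum
    have h0 : ∑ z ∈ X.erase y, ((⟪z, y⟫ - 2) * (⟪z, y⟫ + 3)) ^ 2 = 0 := by linarith
    rw [Finset.sum_eq_zero_iff_of_nonneg (fun _ _ => sq_nonneg _)] at h0
    have := h0 x (Finset.mem_erase.2 ⟨hxy, hx⟩)
    rw [sq_eq_zero_iff, mul_eq_zero] at this
    exact this.imp sub_eq_zero.1 eq_neg_of_add_eq_zero_left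
  sum_one := fun a => by simpa using h1 a
  sum_two := by
    intro a b
    have : ∀ x, ⟪x, a⟫ * ⟪x, b⟫ = (1 / 4) * (⟪x, a + b⟫ ^ 2 - ⟪x, a - b⟫ ^ 2) := fun x => by
      rw [inner_add_right, inner_sub_right]; ring
    simp_rw [this, ← Finset.mul_sum, Finset.sum_sub_distrib, h2]
    simp only [inner_add_left, inner_sub_left, inner_add_right, inner_sub_right,
      real_inner_comm a b]
    ring
  sum_three := by
    intro a b c
    have : ∀ x, ⟪x, a⟫ * ⟪x, b⟫ * ⟪x, c⟫ = (1 / 24) * (⟪x, a + b + c⟫ ^ 3 - ⟪x, a + b - c⟫ ^ 3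
        - ⟪x, a - b + c⟫ ^ 3 + ⟪x, a - b - c⟫ ^ 3) := fun x => by
      simp only [inner_add_right, inner_sub_right]; ring
    simp_rw [this, ← Finset.mul_sum, Finset.sum_add_distrib, Finset.sum_sub_distrib, h3]
    ring
  sum_four := by
    intro a b c d
    have : ∀ x, ⟪x, a⟫ * ⟪x, b⟫ * ⟪x, c⟫ * ⟪x, d⟫ = (1 / 192) *
        (⟪x, a + b + c + d⟫ ^ 4 - ⟪x, a + b + c - d⟫ ^ 4
        - ⟪x, a + b - c + d⟫ ^ 4 - ⟪x, a - b + c + d⟫ ^ 4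
        + ⟪x, a + b - c - d⟫ ^ 4 + ⟪x, a - b + c - d⟫ ^ 4 + ⟪x, a - b - c + d⟫ ^ 4
        - ⟪x, a - b - c - d⟫ ^ 4) := fun x => by
      simp only [inner_add_right, inner_sub_right]; ring
    simp_rw [this, ← Finset.mul_sum, Finset.sum_sub_distrib, Finset.sum_add_distrib,
      Finset.sum_sub_distrib, h4]
    simp only [inner_add_left, inner_sub_left, inner_add_right, inner_sub_right,
      real_inner_comm a b, real_inner_comm a c, real_inner_comm a d, real_inner_comm b c,
      real_inner_comm b d, real_inner_comm c d]
    ring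

lemma card_filter_eq_of_sum {ι : Type*} {s : Finset ι} {p : ι → Prop} [DecidablePred p] {g : ι → ℝ} {c : ℝ} {n : ℕ}
    (hc : c ≠ 0) (hp : ∀ x ∈ s, p x → g x = c) (hn : ∀ x ∈ s, ¬ p x → g x = 0)
    (hsum : ∑ x ∈ s, g x = c * n) : (s.filter p).card = n := by
  have : ∑ x ∈ s, g x = ∑ x ∈ s, if p x then c else 0 :=
    Finset.sum_congr rfl fun x hx => by split_ifs with h; exacts [hp x hx h, hn x hx h]
  rw [this, Finset.sum_ite, Finset.sum_const, Finset.sum_const_zero, nsmul_eq_mul, add_zero,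
    mul_comm] at hsum
  exact_mod_cast mul_left_cancel₀ hc hsum

namespace IsScaledTightDesign

variable {X : Finset E} (h : IsScaledTightDesign X)
include h

lemma sum_quartic (a : E) (c₀ c₁ c₂ c₃ c₄ : ℝ) :
    ∑ x ∈ X, (c₀ + c₁ * ⟪x, a⟫ + c₂ * ⟪x, a⟫ ^ 2 + c₃ * ⟪x, a⟫ ^ 3 + c₄ * ⟪x, a⟫ ^ 4) =
      275 * c₀ + 150 * c₂ * ⟪a, a⟫ + 225 * c₄ * ⟪a, a⟫ ^ 2 := by
  have h2 : ∑ x ∈ X, ⟪x, a⟫ ^ 2 = 150 * ⟪a, a⟫ := by simpa [pow_succ] using h.sum_two a a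
  have h3 : ∑ x ∈ X, ⟪x, a⟫ ^ 3 = 0 := by simpa [pow_succ] using h.sum_three a a a
  have h4 : ∑ x ∈ X, ⟪x, a⟫ ^ 4 = 225 * ⟪a, a⟫ ^ 2 := by
    have := h.sum_four a a a a
    simp only [pow_succ, pow_zero, one_mul]
    rw [this]; ring
  simp_rw [Finset.sum_add_distrib, ← Finset.mul_sum, h.sum_one, h2, h3, h4, Finset.sum_const,
    h.card_eq, nsmul_eq_mul]
  push_cast; ring

lemma exists_int_inner {x y : E} (hx : x ∈ X) (hy : y ∈ X) :
    ∃ j : ℤ, ⟪x, y⟫ = 2 + 5 * j := by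
  by_cases hxy : x = y
  · exact ⟨2, by rw [← hxy, h.inner_self x hx]; norm_num⟩
  · rcases h.inner_eq x hx y hy hxy with h' | h'
    · exact ⟨0, by rw [h']; norm_num⟩
    · exact ⟨-1, by rw [h']; norm_num⟩

/-- A vector whose inner products with the design are integers congruent to 3 modulo 5 and whose
norm is that of a centre of seven points of the design. -/
lemma inner_eq_of_inner_self_eq {u : E} (hu : ⟪u, u⟫ = 56 / 3)
    (hX : ∀ x ∈ X, ∃ j : ℤ, ⟪x, u⟫ = 3 + 5 * j) {x : E} (hx : x ∈ X) :
    ⟪x, u⟫ = 8 ∨ ⟪x, u⟫ = 3 ∨ ⟪x, u⟫ = -2 ∨ ⟪x, u⟫ = -7 := by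
  have hsum : ∑ z ∈ X, (⟪z, u⟫ - 8) * (⟪z, u⟫ - 3) * (⟪z, u⟫ + 2) * (⟪z, u⟫ + 7) = 0 := by
    have := h.sum_quartic u 336 62 (-61) (-2) 1
    rw [hu] at this
    refine (Finset.sum_congr rfl fun z _ => ?_).trans (this.trans (by norm_num))
    ring
  rw [Finset.sum_eq_zero_iff_of_nonneg] at hsum
  · have := hsum x hx
    simp only [mul_eq_zero] at this
    rcases this with ((h1 | h1) | h1) | h1
    · left; linarith
    · right; left; linarith
    · right; right; left; linarith
    · right; right; right; linarith
  · intro z hz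
    obtain ⟨j, hj⟩ := hX z hz
    have : 0 ≤ (j - 1) * j * (j + 1) * (j + 2) := by
      rcases le_or_gt j (-2) with hj | hj
      · nlinarith [mul_nonneg_of_nonpos_of_nonpos (show j + 2 ≤ 0 by lia) (show j - 1 ≤ 0 by lia),
          mul_nonneg_of_nonpos_of_nonpos (show j + 1 ≤ 0 by lia) (show j ≤ 0 by lia)]
      · rcases le_or_gt 1 j with hj | hj
        · have := sub_nonneg.2 hj
          positivity
        · have : j = -1 ∨ j = 0 := by lia
          rcases this with rfl | rfl <;> norm_num
    have h' : (0 : ℝ) ≤ (j - 1) * j * (j + 1) * (j + 2) := by exact_mod_cast this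
    rw [hj]
    nlinarith

lemma card_filter_inner_eq_eight {u : E} (hu : ⟪u, u⟫ = 56 / 3)
    (hX : ∀ x ∈ X, ∃ j : ℤ, ⟪x, u⟫ = 3 + 5 * j) : (X.filter fun x => ⟪x, u⟫ = 8).card = 7 := by
  refine card_filter_eq_of_sum (c := 750)
    (g := fun x => (⟪x, u⟫ - 3) * (⟪x, u⟫ + 2) * (⟪x, u⟫ + 7)) (by norm_num) ?_ ?_ ?_
  · intro x _ hx
    rw [hx]; norm_num
  · intro x hx hne
    rcases h.inner_eq_of_inner_self_eq hu hX hx with h1 | h1 | h1 | h1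
    · exact absurd h1 hne
    all_goals rw [h1]; norm_num
  · have := h.sum_quartic u (-42) (-13) 6 1 0
    rw [hu] at this
    refine (Finset.sum_congr rfl fun z _ => ?_).trans (this.trans (by norm_num))
    ring

lemma inner_eq_of_inner_self_eq' {y : E} (hy : ⟪y, y⟫ = 44 / 3)
    (hX : ∀ x ∈ X, ∃ j : ℤ, ⟪x, y⟫ = 4 + 5 * j) {x : E} (hx : x ∈ X) :
    ⟪x, y⟫ = 4 ∨ ⟪x, y⟫ = -1 ∨ ⟪x, y⟫ = -6 := by
  have hsum : ∑ z ∈ X, (⟪z, y⟫ - 4) * (⟪z, y⟫ + 1) ^ 2 * (⟪z, y⟫ + 6) = 0 := by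
    have := h.sum_quartic y (-24) (-46) (-19) 4 1
    rw [hy] at this
    refine (Finset.sum_congr rfl fun z _ => ?_).trans (this.trans (by norm_num))
    ring
  rw [Finset.sum_eq_zero_iff_of_nonneg] at hsum
  · have := hsum x hx
    simp only [mul_eq_zero, sq_eq_zero_iff] at this
    rcases this with (h1 | h1) | h1
    · left; linarith
    · right; left; linarith
    · right; right; linarith
  · intro z hz
    obtain ⟨j, hj⟩ := hX z hz
    have : 0 ≤ (j * (j + 2)) * (j + 1) ^ 2 := by
      by_cases hj : j = -1
      · rw [hj]; norm_num
      · refine mul_nonneg ?_ (sq_nonneg _)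
        rcases lt_or_gt_of_ne hj with hj | hj <;> nlinarith
    have h' : (0 : ℝ) ≤ (j * (j + 2)) * (j + 1) ^ 2 := by exact_mod_cast this
    rw [hj]
    nlinarith

lemma card_filter_inner_eq_neg_six {y : E} (hy : ⟪y, y⟫ = 44 / 3)
    (hX : ∀ x ∈ X, ∃ j : ℤ, ⟪x, y⟫ = 4 + 5 * j) :
    (X.filter fun x => ⟪x, y⟫ = -6).card = 22 := by
  refine card_filter_eq_of_sum (c := 50) (g := fun x => (⟪x, y⟫ - 4) * (⟪x, y⟫ + 1))
    (by norm_num) ?_ ?_ ?_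
  · intro x _ hx
    rw [hx]; norm_num
  · intro x hx hne
    rcases h.inner_eq_of_inner_self_eq' hy hX hx with h1 | h1 | h1
    · rw [h1]; norm_num
    · rw [h1]; norm_num
    · exact absurd h1 hne
  · have := h.sum_quartic y (-4) (-3) 1 0 0
    rw [hy] at this
    refine (Finset.sum_congr rfl fun z _ => ?_).trans (this.trans (by norm_num))
    ring

lemma inner_eq_two_of_inner_eq_neg_six {y : E} (hy : ⟪y, y⟫ = 44 / 3)
    (hX : ∀ x ∈ X, ∃ j : ℤ, ⟪x, y⟫ = 4 + 5 * j) {a b : E} (ha : a ∈ X) (hb : b ∈ X)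
    (hay : ⟪a, y⟫ = -6) (hby : ⟪b, y⟫ = -6) (hab : a ≠ b) : ⟪a, b⟫ = 2 := by
  set S := X.filter fun x => ⟪x, y⟫ = -6 with hS
  have hcard : S.card = 22 := h.card_filter_inner_eq_neg_six hy hX
  have hsum : ∑ x ∈ X, (⟪x, y⟫ - 4) * (⟪x, y⟫ + 1) * ⟪x, b⟫ = 2700 := by
    have : ∀ x, (⟪x, y⟫ - 4) * (⟪x, y⟫ + 1) * ⟪x, b⟫ =
      ⟪x, y⟫ * ⟪x, y⟫ * ⟪x, b⟫ - 3 * (⟪x, y⟫ * ⟪x, b⟫) - 4 * ⟪x, b⟫ := fun x => by ring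
    simp_rw [this, Finset.sum_sub_distrib, ← Finset.mul_sum, h.sum_one, h.sum_two, h.sum_three,
      real_inner_comm b y, hby]
    norm_num
  have hsum' : ∑ x ∈ X, (⟪x, y⟫ - 4) * (⟪x, y⟫ + 1) * ⟪x, b⟫ = ∑ x ∈ S, 50 * ⟪x, b⟫ := by
    rw [hS, Finset.sum_filter]
    refine Finset.sum_congr rfl fun x hx => ?_
    rcases h.inner_eq_of_inner_self_eq' hy hX hx with h1 | h1 | h1 <;> rw [h1] <;> norm_num
  have hbS : b ∈ S := Finset.mem_filter.2 ⟨hb, hby⟩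
  rw [hsum', ← Finset.mul_sum, ← Finset.add_sum_erase _ _ hbS, h.inner_self b hb] at hsum
  have hzero : ∑ x ∈ S.erase b, (2 - ⟪x, b⟫) = 0 := by
    rw [Finset.sum_sub_distrib, Finset.sum_const, Finset.card_erase_of_mem hbS, hcard]
    norm_num
    linarith
  rw [Finset.sum_eq_zero_iff_of_nonneg] at hzero
  · have := hzero a (Finset.mem_erase.2 ⟨hab, Finset.mem_filter.2 ⟨ha, hay⟩⟩)
    linarith
  · intro x hx
    rw [Finset.mem_erase] at hx
    rcases h.inner_eq x (Finset.mem_filter.1 hx.2).1 b hb hx.1 with h1 | h1 <;> rw [h1] <;> norm_num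

lemma card_filter_inner_eq_two {a : E} (ha : a ∈ X) :
    (X.filter fun x => ⟪a, x⟫ = 2).card = 162 := by
  have hsum : ∑ x ∈ X, (⟪x, a⟫ + 3 - if x = a then 15 else 0) = 5 * (162 : ℕ) := by
    rw [Finset.sum_sub_distrib, Finset.sum_add_distrib, h.sum_one, Finset.sum_const, h.card_eq,
      Finset.sum_ite_eq' X a, if_pos ha]
    norm_num
  refine card_filter_eq_of_sum (by norm_num) ?_ ?_ hsum
  · intro x _ hx
    have : x ≠ a := by rintro rfl; rw [h.inner_self x ha] at hx; norm_num at hx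
    rw [if_neg this, real_inner_comm, hx]; norm_num
  · intro x hx hx2
    by_cases hxa : x = a
    · rw [if_pos hxa, hxa, h.inner_self a ha]; norm_num
    · rw [if_neg hxa, (h.inner_eq x hx a ha hxa).resolve_left (by rwa [real_inner_comm])]; norm_num

lemma card_filter_inner_eq_two_and {a b : E} (ha : a ∈ X) (hb : b ∈ X) (hab : ⟪a, b⟫ = 2) :
    (X.filter fun x => ⟪a, x⟫ = 2 ∧ ⟪b, x⟫ = 2).card = 105 := by
  have hne : a ≠ b := by rintro rfl; rw [h.inner_self a ha] at hab; norm_num at hab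
  have hsum : ∑ x ∈ X, ((⟪x, a⟫ + 3) * (⟪x, b⟫ + 3) - (if x = a then 75 else 0)
      - if x = b then 75 else 0) = 25 * (105 : ℕ) := by
    have : ∀ x, (⟪x, a⟫ + 3) * (⟪x, b⟫ + 3) = ⟪x, a⟫ * ⟪x, b⟫ + 3 * ⟪x, a⟫ + 3 * ⟪x, b⟫ + 9 :=
      fun x => by ring
    simp_rw [Finset.sum_sub_distrib, this, Finset.sum_add_distrib, ← Finset.mul_sum, h.sum_one,
      h.sum_two, Finset.sum_const, h.card_eq,
      Finset.sum_ite_eq' X, if_pos ha, if_pos hb, hab]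
    norm_num
  refine card_filter_eq_of_sum (by norm_num) ?_ ?_ hsum
  · rintro x - ⟨hxa, hxb⟩
    have h1 : x ≠ a := by rintro rfl; rw [h.inner_self x ha] at hxa; norm_num at hxa
    have h2 : x ≠ b := by rintro rfl; rw [h.inner_self x hb] at hxb; norm_num at hxb
    rw [if_neg h1, if_neg h2, real_inner_comm, hxa, real_inner_comm, hxb]; norm_num
  · intro x hx hx2
    by_cases hxa : x = a
    · rw [hxa, if_pos rfl, if_neg hne, h.inner_self a ha, hab]; norm_num
    by_cases hxb : x = b
    · rw [hxb, if_pos rfl, if_neg hne.symm, h.inner_self b hb, real_inner_comm, hab]; norm_num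
    rw [if_neg hxa, if_neg hxb]
    rw [real_inner_comm x a, real_inner_comm x b] at hx2
    rcases h.inner_eq x hx a ha hxa with h1 | h1
    · rcases h.inner_eq x hx b hb hxb with h2 | h2
      · exact absurd ⟨h1, h2⟩ hx2
      · rw [h2]; norm_num
    · rw [h1]; norm_num

end IsScaledTightDesign
end Design

section Lattice

variable {E : Type*} [NormedAddCommGroup E] [InnerProductSpace ℝ E]

namespace IsScaledTightDesign

variable {X : Finset E} (h : IsScaledTightDesign X)
include h

lemma card_filter_inner_eq_four {y : E} (hy : ⟪y, y⟫ = 44 / 3)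
    (hX : ∀ x ∈ X, ∃ j : ℤ, ⟪x, y⟫ = 4 + 5 * j) {a b c : E} (ha : a ∈ X) (hb : b ∈ X) (hc : c ∈ X)
    (hay : ⟪a, y⟫ = -6) (hby : ⟪b, y⟫ = -6) (hcy : ⟪c, y⟫ = -6)
    (hab : a ≠ b) (hac : a ≠ c) (hbc : b ≠ c) :
    (X.filter fun x => ⟪x, y⟫ = 4 ∧ ⟪x, a⟫ = 2 ∧ ⟪x, b⟫ = 2 ∧ ⟪x, c⟫ = 2).card = 1 := by
  have hS := fun p q (hp : p ∈ X) (hq : q ∈ X) =>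
    h.inner_eq_two_of_inner_eq_neg_six (a := p) (b := q) hy hX hp hq
  have hab2 := hS a b ha hb hay hby hab
  have hac2 := hS a c ha hc hay hcy hac
  have hbc2 := hS b c hb hc hby hcy hbc
  refine card_filter_eq_of_sum (c := 625)
    (g := fun x => (⟪x, y⟫ + 1) * ((⟪x, a⟫ + 3) * (⟪x, b⟫ + 3) * (⟪x, c⟫ + 3))
      + 25 / 2 * ((⟪x, y⟫ - 4) * (⟪x, y⟫ + 1))
      + (if x = a then 1250 else 0) + (if x = b then 1250 else 0) + (if x = c then 1250 else 0))
    (by norm_num) ?_ ?_ ?_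
  · rintro x - ⟨h0, h1, h2, h3⟩
    have hxa : x ≠ a := by rintro rfl; rw [hay] at h0; norm_num at h0
    have hxb : x ≠ b := by rintro rfl; rw [hby] at h0; norm_num at h0
    have hxc : x ≠ c := by rintro rfl; rw [hcy] at h0; norm_num at h0
    simp only [if_neg hxa, if_neg hxb, if_neg hxc, h0, h1, h2, h3]
    norm_num
  · intro x hx hne
    by_cases hxa : x = a
    · subst hxa
      simp only [if_true, if_neg hab, if_neg hac, hay, h.inner_self x hx, hab2, hac2]
      norm_num
    by_cases hxb : x = b
    · subst hxb
      simp only [if_true, if_neg hxa, if_neg hbc, hby, h.inner_self x hx, hbc2,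
        real_inner_comm a x, hab2]
      norm_num
    by_cases hxc : x = c
    · subst hxc
      simp only [if_true, if_neg hxa, if_neg hxb, hcy, h.inner_self x hx,
        real_inner_comm a x, hac2, real_inner_comm b x, hbc2]
      norm_num
    simp only [if_neg hxa, if_neg hxb, if_neg hxc]
    rcases h.inner_eq_of_inner_self_eq' hy hX hx with h0 | h0 | h0
    · rcases h.inner_eq x hx a ha hxa with h1 | h1
      · rcases h.inner_eq x hx b hb hxb with h2 | h2
        · rcases h.inner_eq x hx c hc hxc with h3 | h3
          · exact absurd ⟨h0, h1, h2, h3⟩ hne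
          · rw [h0, h3]; norm_num
        · rw [h0, h2]; norm_num
      · rw [h0, h1]; norm_num
    · rw [h0]; norm_num
    · rw [h0, hS x a hx ha h0 hay hxa, hS x b hx hb h0 hby hxb, hS x c hx hc h0 hcy hxc]
      norm_num
  · have : ∀ x, (⟪x, y⟫ + 1) * ((⟪x, a⟫ + 3) * (⟪x, b⟫ + 3) * (⟪x, c⟫ + 3)) =
        ⟪x, y⟫ * ⟪x, a⟫ * ⟪x, b⟫ * ⟪x, c⟫ + 3 * (⟪x, y⟫ * ⟪x, a⟫ * ⟪x, b⟫)
        + 3 * (⟪x, y⟫ * ⟪x, a⟫ * ⟪x, c⟫) + 3 * (⟪x, y⟫ * ⟪x, b⟫ * ⟪x, c⟫)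
        + ⟪x, a⟫ * ⟪x, b⟫ * ⟪x, c⟫ + 9 * (⟪x, y⟫ * ⟪x, a⟫) + 9 * (⟪x, y⟫ * ⟪x, b⟫)
        + 9 * (⟪x, y⟫ * ⟪x, c⟫) + 3 * (⟪x, a⟫ * ⟪x, b⟫) + 3 * (⟪x, a⟫ * ⟪x, c⟫)
        + 3 * (⟪x, b⟫ * ⟪x, c⟫) + 27 * ⟪x, y⟫ + 9 * ⟪x, a⟫ + 9 * ⟪x, b⟫ + 9 * ⟪x, c⟫ + 27 :=
      fun x => by ring
    have h' : ∀ x, (⟪x, y⟫ - 4) * (⟪x, y⟫ + 1) = ⟪x, y⟫ * ⟪x, y⟫ - 3 * ⟪x, y⟫ - 4 :=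
      fun x => by ring
    simp_rw [this, h', Finset.sum_add_distrib, ← Finset.mul_sum, Finset.sum_sub_distrib,
      ← Finset.mul_sum, h.sum_one, h.sum_two, h.sum_three, h.sum_four, Finset.sum_const, h.card_eq,
      Finset.sum_ite_eq' X, if_pos ha, if_pos hb, if_pos hc, real_inner_comm a y,
      real_inner_comm b y, real_inner_comm c y, hay, hby, hcy, hab2, hac2, hbc2, hy]
    norm_num

/-- A vector whose inner products with the design are all divisible by 5 cannot be short. -/
lemma eq_zero_of_inner_self_lt {w : E} (hw : ⟪w, w⟫ < 50 / 3)
    (hX : ∀ x ∈ X, ∃ j : ℤ, ⟪x, w⟫ = 5 * j) : w = 0 := by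
  have hsum : 0 ≤ ∑ x ∈ X, (⟪x, w⟫ ^ 4 - 25 * ⟪x, w⟫ ^ 2) := by
    refine Finset.sum_nonneg fun x hx => ?_
    obtain ⟨j, hj⟩ := hX x hx
    have : 0 ≤ j ^ 4 - j ^ 2 := by
      have h2 : j ^ 2 ≤ (j ^ 2) ^ 2 := by
        rcases (sq_nonneg j).eq_or_lt with h0 | h0
        · rw [← h0]; norm_num
        · nlinarith
      linarith [show (j ^ 2) ^ 2 = j ^ 4 by ring]
    have h' : (0 : ℝ) ≤ j ^ 4 - j ^ 2 := by exact_mod_cast this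
    rw [hj]
    linarith
  have := h.sum_quartic w 0 0 (-25) 0 1
  have heq : ∑ x ∈ X, (⟪x, w⟫ ^ 4 - 25 * ⟪x, w⟫ ^ 2) = 225 * ⟪w, w⟫ ^ 2 - 3750 * ⟪w, w⟫ :=
    (Finset.sum_congr rfl fun x _ => by ring).trans (this.trans (by ring))
  rw [heq] at hsum
  have h0 : 0 ≤ ⟪w, w⟫ := real_inner_self_nonneg
  rw [← inner_self_eq_zero (𝕜 := ℝ)]
  by_contra hne
  have : 0 < ⟪w, w⟫ := lt_of_le_of_ne h0 (Ne.symm hne)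
  nlinarith

/-- The frame identity of the design. -/
lemma sum_inner_smul (a : E) : ∑ x ∈ X, ⟪x, a⟫ • x = (150 : ℝ) • a := by
  refine ext_inner_right ℝ fun c => ?_
  simp_rw [sum_inner, real_inner_smul_left, h.sum_two]

lemma exists_residue_of_mem_span {e : E} (he : e ∈ Submodule.span ℤ (X : Set E)) :
    ∃ s : ℤ, ∀ x ∈ X, ∃ j : ℤ, ⟪x, e⟫ = 2 * s + 5 * j := by
  induction he using Submodule.span_induction with
  | mem y hy =>
    refine ⟨1, fun x hx => ?_⟩
    obtain ⟨j, hj⟩ := h.exists_int_inner hx hy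
    exact ⟨j, by rw [hj]; norm_num⟩
  | zero => exact ⟨0, fun x _ => ⟨0, by simp⟩⟩
  | add y z _ _ hy hz =>
    obtain ⟨s, hs⟩ := hy
    obtain ⟨s', hs'⟩ := hz
    refine ⟨s + s', fun x hx => ?_⟩
    obtain ⟨j, hj⟩ := hs x hx
    obtain ⟨j', hj'⟩ := hs' x hx
    exact ⟨j + j', by rw [inner_add_right, hj, hj']; push_cast; ring⟩
  | smul n y _ hy =>
    obtain ⟨s, hs⟩ := hy
    refine ⟨n * s, fun x hx => ?_⟩
    obtain ⟨j, hj⟩ := hs x hx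
    exact ⟨n * j, by rw [← Int.cast_smul_eq_zsmul ℝ, real_inner_smul_right, hj]; push_cast; ring⟩

omit h in
/-- An integrality property of inner products passes from generators to their integral span. -/
lemma exists_int_mul_inner_of_mem_span {k : ℝ} {w : E} (hw : ∀ x ∈ X, ∃ j : ℤ, ⟪x, w⟫ = k * j)
    {e : E} (he : e ∈ Submodule.span ℤ (X : Set E)) : ∃ j : ℤ, ⟪e, w⟫ = k * j := by
  induction he using Submodule.span_induction with
  | mem y hy => exact hw y hy
  | zero => exact ⟨0, by simp⟩
  | add y z _ _ hy hz =>
    obtain ⟨j, hj⟩ := hy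
    obtain ⟨j', hj'⟩ := hz
    exact ⟨j + j', by rw [inner_add_left, hj, hj']; push_cast; ring⟩
  | smul n y _ hy =>
    obtain ⟨j, hj⟩ := hy
    exact ⟨n * j, by rw [← Int.cast_smul_eq_zsmul ℝ, real_inner_smul_left, hj]; push_cast; ring⟩

lemma exists_int_inner_of_mem_span {e f : E} (he : e ∈ Submodule.span ℤ (X : Set E))
    (hf : f ∈ Submodule.span ℤ (X : Set E)) : ∃ j : ℤ, ⟪e, f⟫ = j := by
  obtain ⟨s, hs⟩ := h.exists_residue_of_mem_span hf
  have := exists_int_mul_inner_of_mem_span (X := X) (k := 1) (w := f) (fun x hx => by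
    obtain ⟨j, hj⟩ := hs x hx
    exact ⟨2 * s + 5 * j, by rw [hj]; push_cast; ring⟩) he
  simpa using this

lemma exists_even_inner_self_of_mem_span {e : E} (he : e ∈ Submodule.span ℤ (X : Set E)) :
    ∃ j : ℤ, ⟪e, e⟫ = 2 * j := by
  induction he using Submodule.span_induction with
  | mem y hy => exact ⟨6, by rw [h.inner_self y hy]; norm_num⟩
  | zero => exact ⟨0, by simp⟩
  | add y z hy' hz' hy hz =>
    obtain ⟨j, hj⟩ := hy
    obtain ⟨j', hj'⟩ := hz
    obtain ⟨k, hk⟩ := h.exists_int_inner_of_mem_span hy' hz'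
    exact ⟨j + j' + k, by rw [real_inner_add_add_self, hj, hj', hk]; push_cast; ring⟩
  | smul n y _ hy =>
    obtain ⟨j, hj⟩ := hy
    exact ⟨n ^ 2 * j, by
      rw [← Int.cast_smul_eq_zsmul ℝ, real_inner_smul_left, real_inner_smul_right, hj]
      push_cast; ring⟩

/-- Every coset of twice the lattice spanned by the design on which the inner products with the
design are integral has a representative with small inner products. -/
lemma exists_mem_span_abs_inner_le {v : E} (hv : ∀ x ∈ X, ∃ j : ℤ, ⟪x, v⟫ = j) :
    ∃ e ∈ Submodule.span ℤ (X : Set E), ∀ x ∈ X, |⟪x, v + (2 : ℝ) • e⟫| ≤ 12 := by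
  let L := Submodule.span ℤ (X : Set E)
  have hint : ∀ e : L, ∃ m : ℕ, 150 * ⟪v + (2 : ℝ) • (e : E), v + (2 : ℝ) • (e : E)⟫ = m := by
    intro e
    have : ∃ m : ℤ, 150 * ⟪v + (2 : ℝ) • (e : E), v + (2 : ℝ) • (e : E)⟫ = m := by
      rw [← h.sum_two]
      have : ∀ x ∈ X, ∃ j : ℤ, ⟪x, v + (2 : ℝ) • (e : E)⟫ = j := by
        intro x hx
        obtain ⟨j, hj⟩ := hv x hx
        obtain ⟨k, hk⟩ := h.exists_int_inner_of_mem_span (Submodule.subset_span hx) e.2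
        exact ⟨j + 2 * k, by rw [inner_add_right, real_inner_smul_right, hj, hk]; push_cast; ring⟩
      choose! j hj using this
      exact ⟨∑ x ∈ X, j x * j x, by
        push_cast
        exact Finset.sum_congr rfl fun x hx => by rw [hj x hx]⟩
    obtain ⟨m, hm⟩ := this
    have h0 : (0 : ℝ) ≤ m := hm ▸ mul_nonneg (by norm_num) real_inner_self_nonneg
    lift m to ℕ using (by exact_mod_cast h0)
    exact ⟨m, by simpa using hm⟩
  choose f hf using hint
  obtain ⟨e, -, hmin⟩ := (measure f).wf.has_min Set.univ ⟨0, trivial⟩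
  have hmin' : ∀ e' : L, ⟪v + (2 : ℝ) • (e : E), v + (2 : ℝ) • (e : E)⟫ ≤
      ⟪v + (2 : ℝ) • (e' : E), v + (2 : ℝ) • (e' : E)⟫ := by
    intro e'
    have h1 : f e ≤ f e' := not_lt.1 (hmin e' trivial)
    have h2 : (f e : ℝ) ≤ f e' := by exact_mod_cast h1
    rw [← hf, ← hf] at h2
    linarith
  refine ⟨e, e.2, fun x hx => ?_⟩
  have hxL : x ∈ L := Submodule.subset_span hx
  have key : ∀ c : ℝ, ⟪v + (2 : ℝ) • (e : E) + (2 * c) • x, v + (2 : ℝ) • (e : E) + (2 * c) • x⟫ =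
      ⟪v + (2 : ℝ) • (e : E), v + (2 : ℝ) • (e : E)⟫ + 4 * c * ⟪x, v + (2 : ℝ) • (e : E)⟫
        + 48 * c ^ 2 := by
    intro c
    rw [real_inner_add_add_self, real_inner_smul_left, real_inner_smul_right, real_inner_smul_right,
      h.inner_self x hx, real_inner_comm x]
    ring
  have h1 := hmin' (e + ⟨x, hxL⟩)
  have h2 := hmin' (e - ⟨x, hxL⟩)
  have e1 : v + (2 : ℝ) • ((e + ⟨x, hxL⟩ : L) : E) = v + (2 : ℝ) • (e : E) + ((2 : ℝ) * 1) • x := by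
    push_cast; module
  have e2 : v + (2 : ℝ) • ((e - ⟨x, hxL⟩ : L) : E) =
      v + (2 : ℝ) • (e : E) + ((2 : ℝ) * (-1)) • x := by
    push_cast; module
  rw [e1, key] at h1
  rw [e2, key] at h2
  rw [abs_le]
  constructor <;> linarith

/-- The lattice spanned by the design is unimodular at the prime 2. -/
lemma exists_eq_two_smul {e : E} (he : e ∈ Submodule.span ℤ (X : Set E))
    (heven : ∀ x ∈ X, ∃ j : ℤ, ⟪x, e⟫ = 2 * j) :
    ∃ f ∈ Submodule.span ℤ (X : Set E), e = (2 : ℤ) • f := by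
  obtain ⟨e', he', hr⟩ := h.exists_mem_span_abs_inner_le fun x hx =>
    (heven x hx).imp' (2 * ·) fun j hj => by rw [hj]; push_cast; ring
  set r := e + (2 : ℝ) • e' with hr_def
  have h2 : ∀ f : E, (2 : ℝ) • f = (2 : ℤ) • f := fun f => by
    rw [← Int.cast_smul_eq_zsmul ℝ]; norm_num
  have hrL : r ∈ Submodule.span ℤ (X : Set E) := by
    rw [hr_def, h2]
    exact add_mem he (Submodule.smul_mem _ _ he')
  suffices hr0 : r = 0 by
    refine ⟨-e', neg_mem he', ?_⟩
    rw [smul_neg, ← h2]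
    exact eq_neg_of_add_eq_zero_left (hr_def ▸ hr0)
  obtain ⟨s, hs⟩ := h.exists_residue_of_mem_span hrL
  obtain ⟨m, hm⟩ := h.exists_int_inner_of_mem_span hrL hrL
  have hval : ∀ x ∈ X, ∃ t j : ℤ, ⟪x, r⟫ = t ∧ t = 2 * s + 10 * j ∧ -12 ≤ t ∧ t ≤ 12 := by
    intro x hx
    obtain ⟨j, hj⟩ := hs x hx
    obtain ⟨k, hk⟩ := heven x hx
    obtain ⟨l, hl⟩ := h.exists_int_inner_of_mem_span (Submodule.subset_span hx) he'
    have h1 : ⟪x, r⟫ = 2 * k + 2 * l := by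
      rw [hr_def, inner_add_right, real_inner_smul_right, hk, hl]
    have h3 : 2 * k + 2 * l = 2 * s + 5 * j := by exact_mod_cast h1.symm.trans hj
    have h4 := abs_le.1 (hr x hx)
    rw [hj] at h4
    refine ⟨2 * s + 5 * j, k + l - s - 2 * j, by rw [hj]; push_cast; ring, by lia, ?_, ?_⟩
    · exact_mod_cast h4.1
    · exact_mod_cast h4.2
  have hzero : ∀ c₀ c₁ c₂ c₃ c₄ : ℤ, (∀ t j : ℤ, t = 2 * s + 10 * j → -12 ≤ t → t ≤ 12 →
      c₀ + c₁ * t + c₂ * t ^ 2 + c₃ * t ^ 3 + c₄ * t ^ 4 = 0) →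
      275 * c₀ + 150 * c₂ * m + 225 * c₄ * m ^ 2 = 0 := by
    intro c₀ c₁ c₂ c₃ c₄ hc
    have := h.sum_quartic r c₀ c₁ c₂ c₃ c₄
    rw [Finset.sum_eq_zero, hm] at this
    · exact_mod_cast this.symm
    · intro x hx
      obtain ⟨t, j, hxt, htj, hl, hu⟩ := hval x hx
      rw [hxt]
      exact_mod_cast hc t j htj hl hu
  have hs5 : s % 5 = 0 ∨ s % 5 = 1 ∨ s % 5 = 2 ∨ s % 5 = 3 ∨ s % 5 = 4 := by lia
  rcases hs5 with hs5 | hs5 | hs5 | hs5 | hs5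
  · have := hzero 0 0 (-100) 0 1 (fun t j ht hl hu => by
      have : t = -10 ∨ t = 0 ∨ t = 10 := by lia
      rcases this with rfl | rfl | rfl <;> norm_num)
    have hm0 : m * (3 * m - 200) = 0 := by linarith
    rcases mul_eq_zero.1 hm0 with h0 | h0
    · rw [← inner_self_eq_zero (𝕜 := ℝ), hm, h0, Int.cast_zero]
    · lia
  · have := hzero 192 (-88) (-6) 1 0 (fun t j ht hl hu => by
      have : t = -8 ∨ t = 2 ∨ t = 12 := by lia
      rcases this with rfl | rfl | rfl <;> norm_num)
    lia
  · have h1 := hzero (-24) 2 1 0 0 (fun t j ht hl hu => by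
      have : t = -6 ∨ t = 4 := by lia
      rcases this with rfl | rfl <;> norm_num)
    have h2 := hzero 0 (-24) 2 1 0 (fun t j ht hl hu => by
      have : t = -6 ∨ t = 4 := by lia
      rcases this with rfl | rfl <;> norm_num)
    lia
  · have h1 := hzero (-24) (-2) 1 0 0 (fun t j ht hl hu => by
      have : t = -4 ∨ t = 6 := by lia
      rcases this with rfl | rfl <;> norm_num)
    have h2 := hzero 0 (-24) (-2) 1 0 (fun t j ht hl hu => by
      have : t = -4 ∨ t = 6 := by lia
      rcases this with rfl | rfl <;> norm_num)
    lia
  · have := hzero (-192) (-88) 6 1 0 (fun t j ht hl hu => by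
      have : t = -12 ∨ t = -2 ∨ t = 8 := by lia
      rcases this with rfl | rfl | rfl <;> norm_num)
    lia

end IsScaledTightDesign
end Lattice

section Determinant

lemma two_mul_eq_zero_or_mul_self_eq_one (a : ZMod 4) : 2 * a = 0 ∨ a * a = 1 := by
  revert a; decide

/-- An even symmetric matrix of size `2m` that is invertible modulo 4 has determinant `(-1)^m`. -/
lemma det_eq_neg_one_pow_of_even_symmetric (m : ℕ) {ι : Type*} [Fintype ι] [DecidableEq ι]
    (hι : Fintype.card ι = 2 * m) (A : Matrix ι ι (ZMod 4)) (hsymm : ∀ i j, A i j = A j i)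
    (heven : ∀ i, 2 * A i i = 0) (hdet : IsUnit A.det) : A.det = (-1) ^ m := by
  induction m generalizing ι with
  | zero =>
    have := Fintype.card_eq_zero_iff.1 (by simpa using hι)
    simp
  | succ m ih =>
    obtain ⟨i⟩ : Nonempty ι := Fintype.card_pos_iff.1 (by lia)
    obtain ⟨j, hj⟩ : ∃ j, 2 * A i j ≠ 0 := by
      by_contra! hcon
      have h1 : (A * A⁻¹) i i = 1 := by rw [Matrix.mul_nonsing_inv A hdet, Matrix.one_apply_eq]
      have h2 : 2 * (A * A⁻¹) i i = 0 := by
        rw [Matrix.mul_apply, Finset.mul_sum]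
        exact Finset.sum_eq_zero fun k _ => by rw [← mul_assoc, hcon, zero_mul]
      rw [h1] at h2
      exact absurd h2 (by decide)
    have hij : i ≠ j := by rintro rfl; exact hj (heven i)
    let e₁ : Fin 2 ≃ {k // k = i ∨ k = j} :=
      { toFun := ![⟨i, .inl rfl⟩, ⟨j, .inr rfl⟩]
        invFun := fun k => if k.1 = i then 0 else 1
        left_inv := fun k => by fin_cases k <;> simp [hij.symm]
        right_inv := by
          rintro ⟨k, rfl | rfl⟩
          · simp
          · simp [hij.symm] }
    let e : Fin 2 ⊕ {k // ¬ (k = i ∨ k = j)} ≃ ι :=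
      (e₁.sumCongr (Equiv.refl _)).trans (Equiv.sumCompl fun k => k = i ∨ k = j)
    have hcard : Fintype.card {k // ¬ (k = i ∨ k = j)} = 2 * m := by
      have := Fintype.card_congr e
      rw [Fintype.card_sum, Fintype.card_fin, hι] at this
      lia
    set M := A.submatrix e e with hM
    have hMs : ∀ k l, M k l = M l k := fun k l => hsymm _ _
    have hMe : ∀ k, 2 * M k k = 0 := fun k => heven _
    have hMdet : M.det = A.det := Matrix.det_submatrix_equiv_self e A
    obtain ⟨a, ha⟩ : ∃ a, a = M (.inl 0) (.inl 0) := ⟨_, rfl⟩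
    obtain ⟨b, hb⟩ : ∃ b, b = M (.inl 0) (.inl 1) := ⟨_, rfl⟩
    obtain ⟨d, hd⟩ : ∃ d, d = M (.inl 1) (.inl 1) := ⟨_, rfl⟩
    have ha2 : 2 * a = 0 := ha ▸ hMe _
    have hd2 : 2 * d = 0 := hd ▸ hMe _
    have hb2 : b * b = 1 := by
      refine (two_mul_eq_zero_or_mul_self_eq_one b).resolve_left ?_
      rw [hb]
      exact hj
    have had : a * d = 0 := by
      clear_value M
      clear ha hd hb hb2
      revert a d; decide
    have h11 : M.toBlocks₁₁ = !![a, b; b, d] := by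
      ext k l
      fin_cases k <;> fin_cases l
      · exact ha.symm
      · exact hb.symm
      · exact (hMs _ _).trans hb.symm
      · exact hd.symm
    have hinv : !![-d, b; b, -a] * M.toBlocks₁₁ = 1 := by
      rw [h11, Matrix.mul_fin_two, Matrix.one_fin_two]
      congr 1
      have e1 : -d * a + b * b = 1 := by linear_combination hb2 - had
      have e2 : -d * b + b * d = 0 := by ring
      have e3 : b * a + -a * b = 0 := by ring
      have e4 : b * b + -a * d = 1 := by linear_combination hb2 - had
      rw [e1, e2, e3, e4]
    let _ : Invertible M.toBlocks₁₁ := invertibleOfLeftInverse _ _ hinv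
    have hinvOf : ⅟M.toBlocks₁₁ = !![-d, b; b, -a] := rfl
    have hdet11 : M.toBlocks₁₁.det = -1 := by
      rw [h11, Matrix.det_fin_two_of, had, hb2, zero_sub]
    set S := M.toBlocks₂₂ - M.toBlocks₂₁ * ⅟M.toBlocks₁₁ * M.toBlocks₁₂ with hS
    have hdetM : M.det = -1 * S.det := by
      conv_lhs => rw [← Matrix.fromBlocks_toBlocks M, Matrix.det_fromBlocks₁₁, hdet11]
    have hSapp : ∀ k l, S k l = M (.inr k) (.inr l)
        - ((-d * M (.inl 0) (.inr k) + b * M (.inl 1) (.inr k)) * M (.inl 0) (.inr l)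
          + (b * M (.inl 0) (.inr k) - a * M (.inl 1) (.inr k)) * M (.inl 1) (.inr l)) := by
      intro k l
      rw [hS, hinvOf]
      simp only [Matrix.sub_apply, Matrix.mul_apply, Fin.sum_univ_two, Matrix.toBlocks₂₂,
        Matrix.toBlocks₂₁, Matrix.toBlocks₁₂, Matrix.of_apply, Matrix.cons_val', Matrix.cons_val_zero,
        Matrix.cons_val_one, Matrix.cons_val_fin_one]
      rw [hMs (.inr k) (.inl 0), hMs (.inr k) (.inl 1)]
      ring
    have h4 : (4 : ZMod 4) = 0 := by decide
    have hSdet := ih hcard S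
      (fun k l => by rw [hSapp, hSapp, hMs (.inr k) (.inr l)]; ring)
      (fun k => by
        rw [hSapp]
        linear_combination hMe (.inr k) + M (.inl 0) (.inr k) ^ 2 * hd2
          + M (.inl 1) (.inr k) ^ 2 * ha2 - b * M (.inl 0) (.inr k) * M (.inl 1) (.inr k) * h4)
      (by
        rw [← hMdet, hdetM] at hdet
        exact isUnit_of_mul_isUnit_right hdet)
    rw [← hMdet, hdetM, hSdet, pow_succ]
    ring

end Determinant

section Glue

variable {E : Type*} [NormedAddCommGroup E] [InnerProductSpace ℝ E]

namespace IsScaledTightDesign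

variable {X : Finset E} (h : IsScaledTightDesign X)
include h

/-- Some vector has all inner products with the design divisible by 5, and a norm prime to 3. -/
lemma exists_glue_vector : ∃ (w : E) (n : E → ℤ), (∀ x ∈ X, ⟪x, w⟫ = 5 * n x) ∧
    ¬ (3 : ℤ) ∣ ∑ x ∈ X, n x ^ 2 := by
  let L := Submodule.span ℤ (X : Set E)
  have : Module.Finite ℤ L := Module.Finite.span_of_finite ℤ X.finite_toSet
  have : IsAddTorsionFree E := .of_isTorsionFree ℝ E
  have : Module.Free ℤ L := inferInstance
  let ι := Module.Free.ChooseBasisIndex ℤ L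
  let b : Module.Basis ι ℤ L := Module.Free.chooseBasis ℤ L
  have hint : ∀ e f : L, ∃ j : ℤ, ⟪(e : E), (f : E)⟫ = j := fun e f =>
    h.exists_int_inner_of_mem_span e.2 f.2
  choose B hB using hint
  let i : X → L := fun x => ⟨x, Submodule.subset_span x.2⟩
  let G : Matrix ι ι ℤ := Matrix.of fun p q => B (b p) (b q)
  let N : Matrix X ι ℤ := Matrix.of fun x p => b.repr (i x) p
  have hcoe : ∀ e : L, (e : E) = ∑ p, (b.repr e p : ℝ) • (b p : E) := by
    intro e
    have := congrArg (Subtype.val : L → E) (b.sum_repr e)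
    rw [← this]
    push_cast
    simp_rw [Int.cast_smul_eq_zsmul]
  have hBexp : ∀ e f : L, B e f = ∑ p, b.repr e p * B (b p) f := by
    intro e f
    have : (B e f : ℝ) = ∑ p, (b.repr e p : ℝ) * B (b p) f := by
      rw [← hB]
      conv_lhs => rw [hcoe e]
      simp_rw [sum_inner, real_inner_smul_left, hB]
    exact_mod_cast this
  have hframe : ∀ f : L, ∑ x : X, B (i x) f • i x = (150 : ℤ) • f := by
    intro f
    ext
    push_cast
    simp_rw [← Int.cast_smul_eq_zsmul ℝ, ← hB]
    rw [Finset.sum_coe_sort X fun x => ⟪x, (f : E)⟫ • x, h.sum_inner_smul]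
    norm_num
  have hNG : (N.transpose * N) * G = (150 : ℤ) • (1 : Matrix ι ι ℤ) := by
    ext p q
    rw [Matrix.mul_assoc, Matrix.mul_apply]
    have h1 : ∀ x : X, (N * G) x q = B (i x) (b q) := fun x => by
      rw [Matrix.mul_apply, hBexp (i x)]; rfl
    have h2 := congrArg (fun e => b.repr e p) (hframe (b q))
    simp only [map_sum, map_smul, Finsupp.coe_finsetSum, Finset.sum_apply, Finsupp.smul_apply,
      Module.Basis.repr_self, smul_eq_mul] at h2
    rw [Matrix.smul_apply, Matrix.one_apply, smul_eq_mul]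
    rw [Finsupp.single_apply] at h2
    simp_rw [eq_comm (a := q)] at h2
    rw [← h2]
    exact Finset.sum_congr rfl fun x _ => by
      rw [h1, Matrix.transpose_apply, mul_comm]; rfl
  have hcard : Fintype.card ι = 22 := by
    have h1 : ((N.transpose * N) * G).trace = 150 * Fintype.card ι := by
      rw [hNG, Matrix.trace_smul, Matrix.trace_one, smul_eq_mul]
    have h2 : ((N.transpose * N) * G).trace = 3300 := by
      rw [Matrix.mul_assoc, Matrix.trace_mul_comm, Matrix.trace]
      have h3 : ∀ x : X, (N * G * N.transpose).diag x = 12 := by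
        intro x
        have hBsymm : ∀ e f, B e f = B f e := fun e f => by
          have : (B e f : ℝ) = B f e := by rw [← hB, ← hB, real_inner_comm]
          exact_mod_cast this
        have h4 : (N * G * N.transpose) x x = B (i x) (i x) := by
          rw [Matrix.mul_apply, hBexp (i x) (i x)]
          refine Finset.sum_congr rfl fun q _ => ?_
          rw [hBsymm (b q), hBexp (i x) (b q), Matrix.mul_apply, mul_comm]
          rfl
        rw [Matrix.diag_apply, h4]
        have : (B (i x) (i x) : ℝ) = 12 := by rw [← hB]; exact h.inner_self x x.2
        exact_mod_cast this
      rw [Finset.sum_congr rfl fun x _ => h3 x, Finset.sum_const, Finset.card_univ,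
        Fintype.card_coe, h.card_eq]
      norm_num
    rw [h1] at h2
    lia
  have hodd : ¬ (2 : ℤ) ∣ G.det := by
    intro h2
    have h0 : (G.map (Int.castRingHom (ZMod 2))).det = 0 := by
      rw [← RingHom.mapMatrix_apply, ← RingHom.map_det]
      exact (ZMod.intCast_zmod_eq_zero_iff_dvd _ 2).2 h2
    obtain ⟨v, hv, hGv⟩ := Matrix.exists_mulVec_eq_zero_iff.2 h0
    let e : L := ∑ q, ((v q).val : ℤ) • b q
    have hrepr : ∀ q, b.repr e q = (v q).val := fun q => by
      simp only [e]; rw [b.repr_sum_self]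
    have hbe : ∀ p, (2 : ℤ) ∣ B (b p) e := by
      intro p
      refine (ZMod.intCast_zmod_eq_zero_iff_dvd _ 2).1 ?_
      have h3 := congrFun hGv p
      have h4 : B (b p) e = ∑ q, G p q * (v q).val := by
        have : (B (b p) e : ℝ) = ∑ q, (B (b p) (b q) : ℝ) * (v q).val := by
          rw [← hB, hcoe e, inner_sum]
          exact Finset.sum_congr rfl fun q _ => by
            rw [real_inner_smul_right, hB, hrepr, mul_comm, Int.cast_natCast]
        exact_mod_cast this
      rw [h4, Int.cast_sum]
      rw [Matrix.mulVec, dotProduct] at h3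
      rw [← Pi.zero_apply (M := fun _ => ZMod 2) p, ← h3]
      refine Finset.sum_congr rfl fun q _ => ?_
      rw [Int.cast_mul, Int.cast_natCast, ZMod.natCast_val, ZMod.cast_id]
      rfl
    obtain ⟨f, hf, hef⟩ := h.exists_eq_two_smul e.2 fun x hx => by
      have : (2 : ℤ) ∣ B (i ⟨x, hx⟩) e := by
        rw [hBexp]
        exact Finset.dvd_sum fun p _ => (hbe p).mul_left _
      obtain ⟨j, hj⟩ := this
      exact ⟨j, by rw [hB (i ⟨x, hx⟩) e, hj]; push_cast; ring⟩
    have hef' : e = (2 : ℤ) • (⟨f, hf⟩ : L) := Subtype.ext hef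
    refine hv (funext fun q => ?_)
    have h5 := hrepr q
    rw [hef', map_smul, Finsupp.smul_apply, smul_eq_mul] at h5
    have h6 := (v q).val_lt
    have h7 : (v q).val = 0 := by lia
    exact (ZMod.val_eq_zero _).1 h7
  have hnonneg : 0 ≤ G.det := by
    have h1 : (0 : ℝ) ≤ (Matrix.gram ℝ fun p => (b p : E)).det :=
      (Matrix.posSemidef_gram ℝ _).det_nonneg
    have h2 : Matrix.gram ℝ (fun p => (b p : E)) = (Int.castRingHom ℝ).mapMatrix G := by
      ext p q
      exact hB _ _
    rw [h2, ← RingHom.map_det, eq_intCast] at h1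
    exact_mod_cast h1
  obtain ⟨p, q, hpq⟩ : ∃ p q, ¬ (3 : ℤ) ∣ (N.transpose * N) p q := by
    by_contra! hcon
    choose K hK using hcon
    have hKG : Matrix.of K * G = (50 : ℤ) • (1 : Matrix ι ι ℤ) := by
      have h1 : N.transpose * N = (3 : ℤ) • Matrix.of K := by
        ext p q; rw [hK p q]; rfl
      rw [h1, Matrix.smul_mul] at hNG
      ext p q
      have := congrFun (congrFun hNG p) q
      simp only [Matrix.smul_apply, smul_eq_mul] at this ⊢
      linarith
    have hdvd : G.det ∣ 50 ^ 22 := by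
      have := congrArg Matrix.det hKG
      rw [Matrix.det_mul, Matrix.det_smul, hcard, Matrix.det_one, mul_one] at this
      exact this ▸ dvd_mul_left _ _
    have hdvd' : G.det ∣ 5 ^ 44 := by
      have hco : IsCoprime G.det (2 ^ 22) :=
        ((Int.prime_two.coprime_iff_not_dvd.2 hodd).symm).pow_right
      refine hco.dvd_of_dvd_mul_left ?_
      convert! hdvd using 1
    obtain ⟨k, -, hk⟩ := (Nat.dvd_prime_pow Nat.prime_five).1
      (show G.det.natAbs ∣ 5 ^ 44 by simpa [Int.natAbs_pow] using Int.natAbs_dvd_natAbs.2 hdvd')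
    have hk' : G.det = 5 ^ k := by
      rw [← Int.natAbs_of_nonneg hnonneg, hk]; push_cast; rfl
    have hdet4 : ((Int.castRingHom (ZMod 4)).mapMatrix G).det = 1 := by
      rw [← RingHom.map_det, hk', map_pow]
      have : (Int.castRingHom (ZMod 4)) 5 = 1 := by decide
      rw [this, one_pow]
    have := det_eq_neg_one_pow_of_even_symmetric 11 (by rw [hcard])
      ((Int.castRingHom (ZMod 4)).mapMatrix G)
      (fun p q => by
        have : (B (b p) (b q) : ℝ) = B (b q) (b p) := by rw [← hB, ← hB, real_inner_comm]
        have h' : G p q = G q p := by exact_mod_cast this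
        simp only [RingHom.mapMatrix_apply, Matrix.map_apply, h'])
      (fun p => by
        obtain ⟨j, hj⟩ := h.exists_even_inner_self_of_mem_span (b p).2
        rw [hB] at hj
        have h' : G p p = 2 * j := by exact_mod_cast hj
        simp only [RingHom.mapMatrix_apply, Matrix.map_apply, h', map_mul]
        rw [← mul_assoc]
        have : (2 : ZMod 4) * (Int.castRingHom (ZMod 4)) 2 = 0 := by decide
        rw [this, zero_mul])
      (by rw [hdet4]; exact isUnit_one)
    rw [hdet4] at this
    exact absurd this (by decide)
  obtain ⟨c, hc⟩ : ∃ c : ι → ℤ, ¬ (3 : ℤ) ∣ ∑ x : X, (∑ p, c p * N x p) ^ 2 := by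
    by_contra! hcon
    have hsingle : ∀ p (x : X), ∑ r, (Pi.single p 1 : ι → ℤ) r * N x r = N x p := fun p x => by
      simp [Pi.single_apply]
    have h1 := hcon (Pi.single p 1)
    have h2 := hcon (Pi.single q 1)
    have h3 := hcon (Pi.single p 1 + Pi.single q 1)
    simp only [Pi.add_apply, add_mul, Finset.sum_add_distrib, hsingle] at h1 h2 h3
    have h4 : ∑ x : X, (N x p + N x q) ^ 2 = ∑ x : X, N x p ^ 2 + ∑ x : X, N x q ^ 2
        + 2 * (N.transpose * N) p q := by
      rw [Matrix.mul_apply, Finset.mul_sum, ← Finset.sum_add_distrib, ← Finset.sum_add_distrib]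
      exact Finset.sum_congr rfl fun x _ => by rw [Matrix.transpose_apply]; ring
    rw [h4] at h3
    lia
  let l : L → ℤ := fun e => ∑ p, c p * b.repr e p
  refine ⟨(1 / 30 : ℝ) • ∑ x : X, (l (i x) : ℝ) • (x : E),
    fun x => if hx : x ∈ X then l (i ⟨x, hx⟩) else 0, fun x hx => ?_, ?_⟩
  · have h1 : ∑ y : X, l (i y) * B (i y) (i ⟨x, hx⟩) = 150 * l (i ⟨x, hx⟩) := by
      have h2 := fun p => congrArg (fun e => b.repr e p) (hframe (i ⟨x, hx⟩))
      simp only [map_sum, map_smul, Finsupp.coe_finsetSum, Finset.sum_apply, Finsupp.smul_apply,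
        smul_eq_mul] at h2
      simp only [l, Finset.mul_sum, Finset.sum_mul]
      rw [Finset.sum_comm]
      refine Finset.sum_congr rfl fun p _ => ?_
      rw [mul_left_comm, ← h2 p, Finset.mul_sum]
      exact Finset.sum_congr rfl fun y _ => by ring
    have h3 : ∑ y : X, (l (i y) : ℝ) * B (i y) (i ⟨x, hx⟩) = 150 * l (i ⟨x, hx⟩) := by
      exact_mod_cast h1
    simp only [dif_pos hx]
    rw [real_inner_smul_right, inner_sum]
    have h4 : ∀ y : X, ⟪x, (l (i y) : ℝ) • (y : E)⟫ = (l (i y) : ℝ) * B (i y) (i ⟨x, hx⟩) := by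
      intro y
      rw [real_inner_smul_right, ← hB, real_inner_comm]
    rw [Finset.sum_congr rfl fun y _ => h4 y, h3]
    ring
  · convert! hc using 2
    rw [← Finset.sum_coe_sort]
    refine Finset.sum_congr rfl fun x _ => ?_
    simp only [dif_pos x.2]
    rfl

end IsScaledTightDesign
end Glue

section Heptad

variable {E : Type*} [NormedAddCommGroup E] [InnerProductSpace ℝ E]

/-- For points of the design, the parity of the number of inner products `-3` with the three given
points, written as a sign. -/
noncomputable def tripleSign (a b c x : E) : ℝ :=
  (2 * ⟪x, a⟫ + 1) * (2 * ⟪x, b⟫ + 1) * (2 * ⟪x, c⟫ + 1) / 125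
    - (if x = a then 4 else 0) - (if x = b then 4 else 0) - (if x = c then 4 else 0)

namespace IsScaledTightDesign

variable {X : Finset E} (h : IsScaledTightDesign X)
include h

lemma ne_of_inner_eq_two {a b : E} (ha : a ∈ X) (hab : ⟪a, b⟫ = 2) : a ≠ b := by
  rintro rfl
  rw [h.inner_self a ha] at hab
  norm_num at hab

section Triple

variable {a b c : E} (ha : a ∈ X) (hb : b ∈ X) (hc : c ∈ X)
  (hab : ⟪a, b⟫ = 2) (hac : ⟪a, c⟫ = 2) (hbc : ⟪b, c⟫ = 2)
include ha hb hc hab hac hbc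

lemma sum_tripleSign : ∑ x ∈ X, tripleSign a b c x = 19 := by
  have : ∀ x, (2 * ⟪x, a⟫ + 1) * (2 * ⟪x, b⟫ + 1) * (2 * ⟪x, c⟫ + 1) / 125 =
      8 / 125 * (⟪x, a⟫ * ⟪x, b⟫ * ⟪x, c⟫) + 4 / 125 * (⟪x, a⟫ * ⟪x, b⟫)
      + 4 / 125 * (⟪x, a⟫ * ⟪x, c⟫) + 4 / 125 * (⟪x, b⟫ * ⟪x, c⟫) + 2 / 125 * ⟪x, a⟫
      + 2 / 125 * ⟪x, b⟫ + 2 / 125 * ⟪x, c⟫ + 1 / 125 := fun x => by ring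
  simp_rw [tripleSign, this, Finset.sum_sub_distrib, Finset.sum_add_distrib, ← Finset.mul_sum,
    h.sum_one, h.sum_two, h.sum_three, Finset.sum_const, h.card_eq, Finset.sum_ite_eq' X, if_pos ha,
    if_pos hb, if_pos hc, hab, hac, hbc]
  norm_num

lemma sum_inner_mul_tripleSign (r : E) :
    ∑ x ∈ X, ⟪x, r⟫ * tripleSign a b c x = 8 * (⟪a, r⟫ + ⟪b, r⟫ + ⟪c, r⟫) := by
  have : ∀ x, ⟪x, r⟫ * tripleSign a b c x =
      8 / 125 * (⟪x, r⟫ * ⟪x, a⟫ * ⟪x, b⟫ * ⟪x, c⟫) + 4 / 125 * (⟪x, r⟫ * ⟪x, a⟫ * ⟪x, b⟫)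
      + 4 / 125 * (⟪x, r⟫ * ⟪x, a⟫ * ⟪x, c⟫) + 4 / 125 * (⟪x, r⟫ * ⟪x, b⟫ * ⟪x, c⟫)
      + 2 / 125 * (⟪x, r⟫ * ⟪x, a⟫) + 2 / 125 * (⟪x, r⟫ * ⟪x, b⟫) + 2 / 125 * (⟪x, r⟫ * ⟪x, c⟫)
      + 1 / 125 * ⟪x, r⟫ - (if x = a then 4 * ⟪x, r⟫ else 0) - (if x = b then 4 * ⟪x, r⟫ else 0)
      - (if x = c then 4 * ⟪x, r⟫ else 0) := fun x => by
    rw [tripleSign]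
    split_ifs <;> ring
  simp_rw [this, Finset.sum_sub_distrib, Finset.sum_add_distrib, ← Finset.mul_sum, h.sum_one,
    h.sum_two, h.sum_three, h.sum_four, Finset.sum_ite_eq' X, if_pos ha, if_pos hb, if_pos hc, hab,
    hac, hbc, real_inner_comm a r, real_inner_comm b r, real_inner_comm c r]
  ring

omit hb hc hbc in
lemma tripleSign_left : tripleSign a b c a = 1 := by
  rw [tripleSign, if_pos rfl, if_neg (h.ne_of_inner_eq_two ha hab),
    if_neg (h.ne_of_inner_eq_two ha hac), h.inner_self a ha, hab, hac]
  norm_num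

omit hc hac in
lemma tripleSign_middle : tripleSign a b c b = 1 := by
  rw [tripleSign, if_pos rfl, if_neg (h.ne_of_inner_eq_two ha hab).symm,
    if_neg (h.ne_of_inner_eq_two hb hbc), h.inner_self b hb, real_inner_comm, hab, hbc]
  norm_num

omit hab in
lemma tripleSign_right : tripleSign a b c c = 1 := by
  rw [tripleSign, if_pos rfl, if_neg (h.ne_of_inner_eq_two ha hac).symm,
    if_neg (h.ne_of_inner_eq_two hb hbc).symm, h.inner_self c hc, real_inner_comm, hac,
    real_inner_comm, hbc]
  norm_num

lemma tripleSign_eq {x : E} (hx : x ∈ X) :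
    (tripleSign a b c x = 1 ∧ ∃ m : ℤ, ⟪x, a + b + c⟫ = 6 + 10 * m) ∨
      (tripleSign a b c x = -1 ∧ ∃ m : ℤ, ⟪x, a + b + c⟫ = 1 + 10 * m) := by
  rw [inner_add_right, inner_add_right]
  by_cases hxa : x = a
  · subst hxa
    exact .inl ⟨h.tripleSign_left ha hab hac, 1, by
      rw [h.inner_self x hx, hab, hac]; norm_num⟩
  by_cases hxb : x = b
  · subst hxb
    exact .inl ⟨h.tripleSign_middle ha hb hab hbc, 1, by
      rw [h.inner_self x hx, real_inner_comm, hab, hbc]; norm_num⟩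
  by_cases hxc : x = c
  · subst hxc
    exact .inl ⟨h.tripleSign_right ha hb hc hac hbc, 1, by
      rw [h.inner_self x hx, real_inner_comm, hac, real_inner_comm, hbc]; norm_num⟩
  rw [tripleSign, if_neg hxa, if_neg hxb, if_neg hxc]
  rcases h.inner_eq x hx a ha hxa with h1 | h1 <;> rcases h.inner_eq x hx b hb hxb with h2 | h2 <;>
    rcases h.inner_eq x hx c hc hxc with h3 | h3 <;> rw [h1, h2, h3]
  · exact .inl ⟨by norm_num, 0, by norm_num⟩
  · exact .inr ⟨by norm_num, 0, by norm_num⟩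
  · exact .inr ⟨by norm_num, 0, by norm_num⟩
  · exact .inl ⟨by norm_num, -1, by norm_num⟩
  · exact .inr ⟨by norm_num, 0, by norm_num⟩
  · exact .inl ⟨by norm_num, -1, by norm_num⟩
  · exact .inl ⟨by norm_num, -1, by norm_num⟩
  · exact .inr ⟨by norm_num, -1, by norm_num⟩

/-- A polynomial relation satisfied by all pairs `(⟪x, r⟫, tripleSign a b c x)` gives a relation
between the norm of `r` and its inner products with the three points. -/
lemma relation_of_forall_eq_zero {r : E} (c₀ c₁ c₂ c₃ c₄ d e : ℝ)
    (hzero : ∀ x ∈ X, c₀ + c₁ * ⟪x, r⟫ + c₂ * ⟪x, r⟫ ^ 2 + c₃ * ⟪x, r⟫ ^ 3 + c₄ * ⟪x, r⟫ ^ 4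
      + d * tripleSign a b c x + e * (⟪x, r⟫ * tripleSign a b c x) = 0) :
    275 * c₀ + 150 * c₂ * ⟪r, r⟫ + 225 * c₄ * ⟪r, r⟫ ^ 2 + 19 * d
      + 8 * e * (⟪a, r⟫ + ⟪b, r⟫ + ⟪c, r⟫) = 0 := by
  have := Finset.sum_eq_zero hzero
  rw [Finset.sum_add_distrib, Finset.sum_add_distrib, h.sum_quartic, ← Finset.mul_sum,
    ← Finset.mul_sum, h.sum_tripleSign ha hb hc hab hac hbc,
    h.sum_inner_mul_tripleSign ha hb hc hab hac hbc] at this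
  linarith

lemma residue_ne_two {r : E} {u : ℤ} (hu : u % 5 = 2)
    (hr : ∀ x ∈ X, ∃ t : ℤ, ⟪x, r⟫ = t ∧ -12 ≤ t ∧ t ≤ 12 ∧
      ((tripleSign a b c x = 1 ∧ t % 10 = (2 * u) % 10) ∨
        (tripleSign a b c x = -1 ∧ t % 10 = (2 * u + 5) % 10))) : False := by
  have := h.relation_of_forall_eq_zero ha hb hc hab hac hbc (r := r) 1677 (-392) (-188) 8 2 1875 0
    (fun x hx => by
      obtain ⟨t, ht, hl, hu', ⟨hs, htu⟩ | ⟨hs, htu⟩⟩ := hr x hx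
      · have : t = -6 ∨ t = 4 := by lia
        rcases this with rfl | rfl <;> rw [ht, hs] <;> norm_num
      · have : t = -11 ∨ t = -1 ∨ t = 9 := by lia
        rcases this with rfl | rfl | rfl <;> rw [ht, hs] <;> norm_num)
  nlinarith [sq_nonneg (⟪r, r⟫ - 94 / 3)]

lemma residue_ne_one {r : E} {u : ℤ} (hu : u % 5 = 1)
    (hthree : ¬ ∃ m : ℤ, 150 * ⟪r, r⟫ = 3 * m)
    (hr : ∀ x ∈ X, ∃ t : ℤ, ⟪x, r⟫ = t ∧ -12 ≤ t ∧ t ≤ 12 ∧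
      ((tripleSign a b c x = 1 ∧ t % 10 = (2 * u) % 10) ∨
        (tripleSign a b c x = -1 ∧ t % 10 = (2 * u + 5) % 10))) : False := by
  have hval : ∀ x ∈ X, (tripleSign a b c x = 1 ∧ (⟪x, r⟫ = -8 ∨ ⟪x, r⟫ = 2 ∨ ⟪x, r⟫ = 12)) ∨
      (tripleSign a b c x = -1 ∧ (⟪x, r⟫ = -3 ∨ ⟪x, r⟫ = 7)) := by
    intro x hx
    obtain ⟨t, ht, hl, hu', ⟨hs, htu⟩ | ⟨hs, htu⟩⟩ := hr x hx
    · have : t = -8 ∨ t = 2 ∨ t = 12 := by lia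
      left
      rcases this with rfl | rfl | rfl <;> rw [ht, hs] <;> norm_num
    · have : t = -3 ∨ t = 7 := by lia
      right
      rcases this with rfl | rfl <;> rw [ht, hs] <;> norm_num
  have h1 := h.relation_of_forall_eq_zero ha hb hc hab hac hbc (r := r) (-1107) (-736) 152 16 (-2)
    1875 0 (fun x hx => by
      rcases hval x hx with ⟨hs, ht | ht | ht⟩ | ⟨hs, ht | ht⟩ <;> rw [hs, ht] <;> norm_num)
  have h2 : (⟪r, r⟫ - 32) * (⟪r, r⟫ - 56 / 3) = 0 := by linarith
  have hQ : ⟪r, r⟫ = 56 / 3 := by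
    rcases mul_eq_zero.1 h2 with h3 | h3
    · exact absurd ⟨1600, by rw [sub_eq_zero.1 h3]; norm_num⟩ hthree
    · exact sub_eq_zero.1 h3
  have hsum : ∑ x ∈ X, (⟪x, r⟫ + 8) * (⟪x, r⟫ + 3) * (⟪x, r⟫ - 2) * (⟪x, r⟫ - 7) = 0 := by
    have := h.sum_quartic r 336 (-62) (-61) 2 1
    rw [hQ] at this
    refine (Finset.sum_congr rfl fun z _ => ?_).trans (this.trans (by norm_num))
    ring
  have h12 : ∀ x ∈ X, ⟪x, r⟫ ≠ 12 := by
    rw [Finset.sum_eq_zero_iff_of_nonneg] at hsum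
    · intro x hx ht
      have := hsum x hx
      rw [ht] at this
      norm_num at this
    · intro x hx
      rcases hval x hx with ⟨-, ht | ht | ht⟩ | ⟨-, ht | ht⟩ <;> rw [ht] <;> norm_num
  have h3 := h.relation_of_forall_eq_zero ha hb hc hab hac hbc (r := r) 1344 (-161) (-72) 2 0
    0 (-375) (fun x hx => by
      rcases hval x hx with ⟨hs, ht | ht | ht⟩ | ⟨hs, ht | ht⟩
      · rw [hs, ht]; norm_num
      · rw [hs, ht]; norm_num
      · exact absurd ht (h12 x hx)
      · rw [hs, ht]; norm_num
      · rw [hs, ht]; norm_num)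
  have hle : ∀ x ∈ X, tripleSign a b c x = 1 → ⟪x, r⟫ ≤ 2 := by
    intro x hx hs1
    rcases hval x hx with ⟨hs, ht | ht | ht⟩ | ⟨hs, ht | ht⟩
    · rw [ht]; norm_num
    · rw [ht]
    · exact absurd ht (h12 x hx)
    · rw [hs] at hs1; norm_num at hs1
    · rw [hs] at hs1; norm_num at hs1
  have h4 := hle a ha (h.tripleSign_left ha hab hac)
  have h5 := hle b hb (h.tripleSign_middle ha hb hab hbc)
  have h6 := hle c hc (h.tripleSign_right ha hb hc hac hbc)
  rw [hQ] at h3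
  linarith

lemma norm_eq_of_residue {r : E} {u : ℤ} (hthree : ¬ ∃ m : ℤ, 150 * ⟪r, r⟫ = 3 * m)
    (hr : ∀ x ∈ X, ∃ t : ℤ, ⟪x, r⟫ = t ∧ -12 ≤ t ∧ t ≤ 12 ∧
      ((tripleSign a b c x = 1 ∧ t % 10 = (2 * u) % 10) ∨
        (tripleSign a b c x = -1 ∧ t % 10 = (2 * u + 5) % 10))) :
    u % 5 = 0 ∧ ⟪r, r⟫ = 80 / 3 ∧ ⟪a, r⟫ + ⟪b, r⟫ + ⟪c, r⟫ = 0 := by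
  have hneg : ∀ x ∈ X, ∃ t : ℤ, ⟪x, -r⟫ = t ∧ -12 ≤ t ∧ t ≤ 12 ∧
      ((tripleSign a b c x = 1 ∧ t % 10 = (2 * -u) % 10) ∨
        (tripleSign a b c x = -1 ∧ t % 10 = (2 * -u + 5) % 10)) := by
    intro x hx
    obtain ⟨t, ht, hl, hu', hs⟩ := hr x hx
    refine ⟨-t, by rw [inner_neg_right, ht]; push_cast; rfl, by lia, by lia, ?_⟩
    exact hs.imp (fun hs => ⟨hs.1, by lia⟩) (fun hs => ⟨hs.1, by lia⟩)
  have hthree' : ¬ ∃ m : ℤ, 150 * ⟪-r, -r⟫ = 3 * m := by rwa [inner_neg_neg]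
  have hu : u % 5 = 0 := by
    have hu5 : u % 5 = 0 ∨ u % 5 = 1 ∨ u % 5 = 2 ∨ (-u) % 5 = 2 ∨ (-u) % 5 = 1 := by lia
    rcases hu5 with h0 | h0 | h0 | h0 | h0
    · exact h0
    · exact (h.residue_ne_one ha hb hc hab hac hbc h0 hthree hr).elim
    · exact (h.residue_ne_two ha hb hc hab hac hbc h0 hr).elim
    · exact (h.residue_ne_two ha hb hc hab hac hbc h0 hneg).elim
    · exact (h.residue_ne_one ha hb hc hab hac hbc h0 hthree' hneg).elim
  have hval : ∀ x ∈ X, (tripleSign a b c x = 1 ∧ (⟪x, r⟫ = -10 ∨ ⟪x, r⟫ = 0 ∨ ⟪x, r⟫ = 10)) ∨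
      (tripleSign a b c x = -1 ∧ (⟪x, r⟫ = -5 ∨ ⟪x, r⟫ = 5)) := by
    intro x hx
    obtain ⟨t, ht, hl, hu', ⟨hs, htu⟩ | ⟨hs, htu⟩⟩ := hr x hx
    · have : t = -10 ∨ t = 0 ∨ t = 10 := by lia
      left
      rcases this with rfl | rfl | rfl <;> rw [ht, hs] <;> norm_num
    · have : t = -5 ∨ t = 5 := by lia
      right
      rcases this with rfl | rfl <;> rw [ht, hs] <;> norm_num
  have h1 := h.relation_of_forall_eq_zero ha hb hc hab hac hbc (r := r) (-1875) 0 200 0 (-2)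
    1875 0 (fun x hx => by
      rcases hval x hx with ⟨hs, ht | ht | ht⟩ | ⟨hs, ht | ht⟩ <;> rw [hs, ht] <;> norm_num)
  have h2 : (⟪r, r⟫ - 40) * (⟪r, r⟫ - 80 / 3) = 0 := by linarith
  have h3 := h.relation_of_forall_eq_zero ha hb hc hab hac hbc (r := r) 0 125 0 (-2) 0
    0 75 (fun x hx => by
      rcases hval x hx with ⟨hs, ht | ht | ht⟩ | ⟨hs, ht | ht⟩ <;> rw [hs, ht] <;> norm_num)
  refine ⟨hu, ?_, by linarith⟩
  rcases mul_eq_zero.1 h2 with h3 | h3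
  · exact absurd ⟨2000, by rw [sub_eq_zero.1 h3]; norm_num⟩ hthree
  · exact sub_eq_zero.1 h3

lemma inner_self_add_add : ⟪a + b + c, a + b + c⟫ = 48 := by
  simp only [inner_add_left, inner_add_right, h.inner_self a ha, h.inner_self b hb,
    h.inner_self c hc, real_inner_comm a b, real_inner_comm a c, real_inner_comm b c, hab, hac, hbc]
  norm_num

/-- Three points of the design with mutual inner products 2 lie in a heptad. -/
lemma exists_heptad_center : ∃ u : E, ⟪u, u⟫ = 56 / 3 ∧ (∀ x ∈ X, ∃ j : ℤ, ⟪x, u⟫ = 3 + 5 * j) ∧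
    ⟪a, u⟫ = 8 ∧ ⟪b, u⟫ = 8 ∧ ⟪c, u⟫ = 8 := by
  obtain ⟨w, n, hw, hn⟩ := h.exists_glue_vector
  have hgL : a + b + c ∈ Submodule.span ℤ (X : Set E) :=
    add_mem (add_mem (Submodule.subset_span ha) (Submodule.subset_span hb))
      (Submodule.subset_span hc)
  set g := a + b + c with hg
  obtain ⟨e, he, hle⟩ := h.exists_mem_span_abs_inner_le (v := g - (2 : ℝ) • w) fun x hx => by
    obtain ⟨j, hj⟩ := h.exists_int_inner_of_mem_span (Submodule.subset_span hx) hgL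
    exact ⟨j - 10 * n x, by
      rw [inner_sub_right, real_inner_smul_right, hj, hw x hx]; push_cast; ring⟩
  set r := g - (2 : ℝ) • w + (2 : ℝ) • e with hr
  obtain ⟨s, hs⟩ := h.exists_residue_of_mem_span he
  have hthree : ¬ ∃ m : ℤ, 150 * ⟪r, r⟫ = 3 * m := by
    rintro ⟨m, hm⟩
    have hfL : g + (2 : ℝ) • e ∈ Submodule.span ℤ (X : Set E) := by
      rw [two_smul]
      exact add_mem hgL (add_mem he he)
    obtain ⟨p, hp⟩ := h.exists_int_inner_of_mem_span hfL hfL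
    obtain ⟨q, hq⟩ := exists_int_mul_inner_of_mem_span (X := X) (k := 5) (w := w)
      (fun x hx => ⟨n x, hw x hx⟩) hfL
    have hww : 150 * ⟪w, w⟫ = 25 * ((∑ x ∈ X, n x ^ 2 : ℤ) : ℝ) := by
      rw [← h.sum_two, Int.cast_sum, Finset.mul_sum]
      exact Finset.sum_congr rfl fun x hx => by rw [hw x hx]; push_cast; ring
    have hrr : 150 * ⟪r, r⟫ = 150 * p - 3000 * q + 100 * ((∑ x ∈ X, n x ^ 2 : ℤ) : ℝ) := by
      have : r = g + (2 : ℝ) • e - (2 : ℝ) • w := by rw [hr]; abel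
      rw [this, real_inner_sub_sub_self, hp, real_inner_smul_right, hq, real_inner_smul_left,
        real_inner_smul_right]
      linarith
    rw [hm] at hrr
    have : 3 * m = 150 * p - 3000 * q + 100 * ∑ x ∈ X, n x ^ 2 := by exact_mod_cast hrr
    exact hn (by lia)
  obtain ⟨hs5, hQ, hρ⟩ := h.norm_eq_of_residue ha hb hc hab hac hbc (u := 3 + 2 * s) hthree
    (fun x hx => by
      obtain ⟨j, hj⟩ := hs x hx
      have hle := abs_le.1 (hle x hx)
      have hxr : ⟪x, r⟫ = ⟪x, g⟫ - 10 * n x + 4 * s + 10 * j := by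
        rw [hr, inner_add_right, inner_sub_right, real_inner_smul_right, real_inner_smul_right, hj,
          hw x hx]
        ring
      rcases h.tripleSign_eq ha hb hc hab hac hbc hx with ⟨hsign, m, hm⟩ | ⟨hsign, m, hm⟩
      · have hxt : ⟪x, r⟫ = ((6 + 10 * m - 10 * n x + 4 * s + 10 * j : ℤ) : ℝ) := by
          rw [hxr, hm]; push_cast; ring
        rw [hxt] at hle
        exact ⟨_, hxt, by exact_mod_cast hle.1, by exact_mod_cast hle.2, .inl ⟨hsign, by lia⟩⟩
      · have hxt : ⟪x, r⟫ = ((1 + 10 * m - 10 * n x + 4 * s + 10 * j : ℤ) : ℝ) := by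
          rw [hxr, hm]; push_cast; ring
        rw [hxt] at hle
        exact ⟨_, hxt, by exact_mod_cast hle.1, by exact_mod_cast hle.2, .inr ⟨hsign, by lia⟩⟩)
  have hue : w - e = (1 / 2 : ℝ) • (g - r) := by rw [hr]; module
  have hgg : ⟪g, g⟫ = 48 := h.inner_self_add_add ha hb hc hab hac hbc
  have hgr : ⟪g, r⟫ = 0 := by rw [hg, inner_add_left, inner_add_left, hρ]
  have hnorm : ⟪w - e, w - e⟫ = 56 / 3 := by
    rw [hue, real_inner_smul_left, real_inner_smul_right, real_inner_sub_sub_self, hgg, hgr, hQ]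
    norm_num
  have hres : ∀ x ∈ X, ∃ j : ℤ, ⟪x, w - e⟫ = 3 + 5 * j := by
    intro x hx
    obtain ⟨j, hj⟩ := hs x hx
    obtain ⟨k, hk⟩ : ∃ k, s = 1 + 5 * k := ⟨s / 5, by lia⟩
    exact ⟨n x - 1 - 2 * k - j, by rw [inner_sub_right, hw x hx, hj, hk]; push_cast; ring⟩
  have hle8 : ∀ x ∈ X, ⟪x, w - e⟫ ≤ 8 := by
    intro x hx
    rcases h.inner_eq_of_inner_self_eq hnorm hres hx with h1 | h1 | h1 | h1 <;> rw [h1] <;> norm_num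
  have hsum : ⟪a, w - e⟫ + ⟪b, w - e⟫ + ⟪c, w - e⟫ = 24 := by
    rw [← inner_add_left, ← inner_add_left, ← hg, hue, real_inner_smul_right, inner_sub_right, hgg,
      hgr]
    norm_num
  have ha8 := hle8 a ha
  have hb8 := hle8 b hb
  have hc8 := hle8 c hc
  exact ⟨w - e, hnorm, hres, by linarith, by linarith, by linarith⟩

/-- Three points of the design with mutual inner products 2 lie in exactly two heptads. -/
lemma exists_two_heptad_centers : ∃ u v : E, u ≠ v ∧ ∀ z : E,
    (⟪z, z⟫ = 56 / 3 ∧ (∀ x ∈ X, ∃ j : ℤ, ⟪x, z⟫ = 3 + 5 * j) ∧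
      ⟪a, z⟫ = 8 ∧ ⟪b, z⟫ = 8 ∧ ⟪c, z⟫ = 8) ↔ z = u ∨ z = v := by
  obtain ⟨u, huu, hu, hau, hbu, hcu⟩ := h.exists_heptad_center ha hb hc hab hac hbc
  have hgg := h.inner_self_add_add ha hb hc hab hac hbc
  have hgres : ∀ x ∈ X, ∃ j : ℤ, ⟪x, a + b + c⟫ = 1 + 5 * j := by
    intro x hx
    rcases h.tripleSign_eq ha hb hc hab hac hbc hx with ⟨-, m, hm⟩ | ⟨-, m, hm⟩
    · exact ⟨1 + 2 * m, by rw [hm]; push_cast; ring⟩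
    · exact ⟨2 * m, by rw [hm]; push_cast; ring⟩
  have hin : ∀ z, ⟪a, z⟫ = 8 → ⟪b, z⟫ = 8 → ⟪c, z⟫ = 8 → ⟪a + b + c, z⟫ = 24 := by
    intro z h1 h2 h3
    rw [inner_add_left, inner_add_left, h1, h2, h3]
    norm_num
  have hag : ⟪a, a + b + c⟫ = 16 := by
    rw [inner_add_right, inner_add_right, h.inner_self a ha, hab, hac]; norm_num
  have hbg : ⟪b, a + b + c⟫ = 16 := by
    rw [inner_add_right, inner_add_right, h.inner_self b hb, real_inner_comm, hab, hbc]; norm_num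
  have hcg : ⟪c, a + b + c⟫ = 16 := by
    rw [inner_add_right, inner_add_right, h.inner_self c hc, real_inner_comm, hac, real_inner_comm,
      hbc]
    norm_num
  set g := a + b + c with hg
  have hgu := hin u hau hbu hcu
  refine ⟨u, g - u, fun heq => ?_, fun z => ⟨?_, ?_⟩⟩
  · have h1 : ⟪u, g - u⟫ = 56 / 3 := by rw [← heq, huu]
    rw [inner_sub_right, real_inner_comm, hgu, huu] at h1
    norm_num at h1
  · rintro ⟨hzz, hz, haz, hbz, hcz⟩
    have hgz := hin z haz hbz hcz
    have hsum : ⟪z - u, z - u⟫ + ⟪z - (g - u), z - (g - u)⟫ = 80 / 3 := by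
      simp only [inner_sub_left, inner_sub_right, real_inner_comm g z, real_inner_comm g u,
        real_inner_comm z u, hgz, hgu, hgg, hzz, huu]
      ring
    rcases lt_or_ge ⟪z - u, z - u⟫ (50 / 3) with hlt | hge
    · refine .inl (sub_eq_zero.1 (h.eq_zero_of_inner_self_lt hlt fun x hx => ?_))
      obtain ⟨j, hj⟩ := hz x hx
      obtain ⟨k, hk⟩ := hu x hx
      exact ⟨j - k, by rw [inner_sub_right, hj, hk]; push_cast; ring⟩
    · refine .inr (sub_eq_zero.1 (h.eq_zero_of_inner_self_lt (by linarith) fun x hx => ?_))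
      obtain ⟨j, hj⟩ := hz x hx
      obtain ⟨k, hk⟩ := hu x hx
      obtain ⟨l, hl⟩ := hgres x hx
      exact ⟨1 + j + k - l, by
        rw [inner_sub_right, inner_sub_right, hj, hk, hl]; push_cast; ring⟩
  · rintro (rfl | rfl)
    · exact ⟨huu, hu, hau, hbu, hcu⟩
    · refine ⟨by rw [real_inner_sub_sub_self, hgg, hgu, huu]; norm_num, fun x hx => ?_, ?_, ?_, ?_⟩
      · obtain ⟨k, hk⟩ := hu x hx
        obtain ⟨l, hl⟩ := hgres x hx
        exact ⟨l - k - 1, by rw [inner_sub_right, hk, hl]; push_cast; ring⟩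
      · rw [inner_sub_right, hag, hau]; norm_num
      · rw [inner_sub_right, hbg, hbu]; norm_num
      · rw [inner_sub_right, hcg, hcu]; norm_num

end Triple
end IsScaledTightDesign
end Heptad

section Counting

/-- Counting ordered triples of pairwise related elements. -/
lemma card_filter_triples {α : Type*} (R : α → α → Prop) (A : Finset α) (m k : ℕ)
    (hm : ∀ a ∈ A, (A.filter fun b => R a b).card = m)
    (hk : ∀ a ∈ A, ∀ b ∈ A, R a b → (A.filter fun c => R a c ∧ R b c).card = k) :
    ((A ×ˢ A ×ˢ A).filter fun p => R p.1 p.2.1 ∧ R p.1 p.2.2 ∧ R p.2.1 p.2.2).card =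
      A.card * (m * k) := by
  rw [Finset.card_filter, Finset.sum_product, ← smul_eq_mul A.card]
  refine Finset.sum_eq_card_nsmul fun a ha => ?_
  rw [Finset.sum_product, ← hm a ha, ← smul_eq_mul _ k, ← Finset.sum_const, Finset.sum_filter]
  refine Finset.sum_congr rfl fun b hb => ?_
  split_ifs with hab
  · rw [← hk a ha b hb hab, Finset.card_filter]
    simp only [hab, true_and]
  · simp only [hab, false_and, if_false, Finset.sum_const_zero]

variable {E : Type*} [NormedAddCommGroup E] [InnerProductSpace ℝ E]

/-- The dual points of a scaled tight design. -/
def dualPoints (X : Finset E) : Set E :=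
  {y | ⟪y, y⟫ = 44 / 3 ∧ ∀ x ∈ X, ∃ j : ℤ, ⟪x, y⟫ = 4 + 5 * j}

namespace IsScaledTightDesign

variable {X : Finset E} (h : IsScaledTightDesign X)
include h

lemma finite_dualPoints : (dualPoints X).Finite := by
  have hpi : (Set.univ.pi fun _ : X => ({4, -1, -6} : Set ℝ)).Finite :=
    Set.Finite.pi fun _ => Set.toFinite _
  refine Set.Finite.of_injOn (f := fun y (x : X) => ⟪(x : E), y⟫) ?_ ?_ hpi
  · intro y hy x _
    simpa using h.inner_eq_of_inner_self_eq' hy.1 hy.2 x.2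
  · intro y _ z _ hyz
    have : (150 : ℝ) • y = (150 : ℝ) • z := by
      rw [← h.sum_inner_smul, ← h.sum_inner_smul]
      exact Finset.sum_congr rfl fun x hx => by rw [show ⟪x, y⟫ = ⟪x, z⟫ from congrFun hyz ⟨x, hx⟩]
    exact smul_right_injective E (by norm_num : (150 : ℝ) ≠ 0) this

lemma card_filter_dualPoints {a b c : E} (ha : a ∈ X) (hb : b ∈ X) (hc : c ∈ X)
    (hab : ⟪a, b⟫ = 2) (hac : ⟪a, c⟫ = 2) (hbc : ⟪b, c⟫ = 2) :
    (h.finite_dualPoints.toFinset.filter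
      fun y => ⟪a, y⟫ = -6 ∧ ⟪b, y⟫ = -6 ∧ ⟪c, y⟫ = -6).card = 8 := by
  obtain ⟨u, v, huv, hU⟩ := h.exists_two_heptad_centers ha hb hc hab hac hbc
  have hneab := h.ne_of_inner_eq_two ha hab
  have hneac := h.ne_of_inner_eq_two ha hac
  have hnebc := h.ne_of_inner_eq_two hb hbc
  let H : E → Finset E := fun z => (X.filter fun x => ⟪x, z⟫ = 8) \ {a, b, c}
  have hcard : (({u, v} : Finset E).sigma H).card = 8 := by
    rw [Finset.card_sigma, Finset.sum_const_nat (m := 4), Finset.card_pair huv]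
    intro z hz
    obtain ⟨hzz, hz, haz, hbz, hcz⟩ := (hU z).2 (by simpa using hz)
    rw [Finset.card_sdiff_of_subset, h.card_filter_inner_eq_eight hzz hz,
      Finset.card_eq_three.2 ⟨a, b, c, hneab, hneac, hnebc, rfl⟩]
    intro x hx
    simp only [Finset.mem_insert, Finset.mem_singleton] at hx
    rcases hx with rfl | rfl | rfl <;> simp [*]
  have hmem : ∀ p ∈ ({u, v} : Finset E).sigma H, p.2 - p.1 ∈ dualPoints X ∧ p.2 ∈ X ∧
      ⟪p.2, p.2 - p.1⟫ = 4 ∧ (⟪p.2, a⟫ = 2 ∧ ⟪p.2, b⟫ = 2 ∧ ⟪p.2, c⟫ = 2) ∧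
      ⟪a, p.2 - p.1⟫ = -6 ∧ ⟪b, p.2 - p.1⟫ = -6 ∧ ⟪c, p.2 - p.1⟫ = -6 := by
    rintro ⟨z, k⟩ hp
    rw [Finset.mem_sigma] at hp
    obtain ⟨hzz, hz, haz, hbz, hcz⟩ := (hU z).2 (by simpa using hp.1)
    simp only [H, Finset.mem_sdiff, Finset.mem_filter, Finset.mem_insert, Finset.mem_singleton,
      not_or] at hp
    obtain ⟨-, ⟨hk, hkz⟩, hka, hkb, hkc⟩ := hp
    have hy : k - z ∈ dualPoints X := by
      refine ⟨?_, fun x hx => ?_⟩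
      · rw [real_inner_sub_sub_self, h.inner_self k hk, hkz, hzz]; norm_num
      · obtain ⟨i, hi⟩ := h.exists_int_inner hx hk
        obtain ⟨j, hj⟩ := hz x hx
        exact ⟨i - j - 1, by rw [inner_sub_right, hi, hj]; push_cast; ring⟩
    have key : ∀ x ∈ X, k ≠ x → ⟪x, z⟫ = 8 → ⟪k, x⟫ = 2 ∧ ⟪x, k - z⟫ = -6 := by
      intro x hx hkx hxz
      have h1 := h.inner_eq_of_inner_self_eq' hy.1 hy.2 hx
      rw [inner_sub_right, hxz, real_inner_comm] at h1
      rcases h.inner_eq k hk x hx hkx with h2 | h2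
      · exact ⟨h2, by rw [inner_sub_right, hxz, real_inner_comm, h2]; norm_num⟩
      · rw [h2] at h1
        norm_num at h1
    exact ⟨hy, hk, by rw [inner_sub_right, h.inner_self k hk, hkz]; norm_num,
      ⟨(key a ha hka haz).1, (key b hb hkb hbz).1, (key c hc hkc hcz).1⟩,
      (key a ha hka haz).2, (key b hb hkb hbz).2, (key c hc hkc hcz).2⟩
  rw [← hcard]
  symm
  refine Finset.card_bij (fun p _ => p.2 - p.1) ?_ ?_ ?_
  · intro p hp
    obtain ⟨hy, -, -, -, h6⟩ := hmem p hp
    simpa [hy] using h6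
  · rintro ⟨z, k⟩ hp ⟨z', k'⟩ hp' heq
    obtain ⟨hy, hk, hk4, hk2, h6a, h6b, h6c⟩ := hmem _ hp
    obtain ⟨-, hk', hk4', hk2', -⟩ := hmem _ hp'
    simp only at hy hk hk4 hk2 h6a h6b h6c hk' hk4' hk2' heq
    have hone := h.card_filter_inner_eq_four hy.1 hy.2 ha hb hc h6a h6b h6c hneab hneac hnebc
    have hkk : k = k' := Finset.card_le_one.1 hone.le k (Finset.mem_filter.2 ⟨hk, hk4, hk2⟩) k'
      (Finset.mem_filter.2 ⟨hk', by rw [heq]; exact hk4', hk2'⟩)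
    subst hkk
    rw [sub_right_inj.1 heq]
  · intro y hy
    rw [Finset.mem_filter, Set.Finite.mem_toFinset] at hy
    obtain ⟨⟨hyy, hy⟩, h6a, h6b, h6c⟩ := hy
    have hone := h.card_filter_inner_eq_four hyy hy ha hb hc h6a h6b h6c hneab hneac hnebc
    obtain ⟨k, hk⟩ := Finset.card_pos.1 (hone ▸ Nat.one_pos)
    obtain ⟨hk, hk4, hka, hkb, hkc⟩ := Finset.mem_filter.1 hk
    have hne : ∀ x ∈ X, ⟪k, x⟫ = 2 → k ≠ x := fun x _ hkx => h.ne_of_inner_eq_two hk hkx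
    refine ⟨⟨k - y, k⟩, ?_, by simp⟩
    rw [Finset.mem_sigma]
    constructor
    · suffices k - y = u ∨ k - y = v by simpa using this
      refine (hU _).1 ⟨?_, fun x hx => ?_, ?_, ?_, ?_⟩
      · rw [real_inner_sub_sub_self, h.inner_self k hk, hk4, hyy]; norm_num
      · obtain ⟨i, hi⟩ := h.exists_int_inner hx hk
        obtain ⟨j, hj⟩ := hy x hx
        exact ⟨i - j - 1, by rw [inner_sub_right, hi, hj]; push_cast; ring⟩
      · rw [inner_sub_right, real_inner_comm, hka, h6a]; norm_num
      · rw [inner_sub_right, real_inner_comm, hkb, h6b]; norm_num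
      · rw [inner_sub_right, real_inner_comm, hkc, h6c]; norm_num
    · have hk8 : ⟪k, k - y⟫ = 8 := by rw [inner_sub_right, h.inner_self k hk, hk4]; norm_num
      simp only [H, Finset.mem_sdiff, Finset.mem_filter, Finset.mem_insert, Finset.mem_singleton,
        not_or]
      exact ⟨⟨hk, hk8⟩, hne a ha hka, hne b hb hkb, hne c hc hkc⟩

/-- A scaled tight design has exactly 4050 dual points. -/
theorem ncard_dualPoints : (dualPoints X).ncard = 4050 := by
  rw [Set.ncard_eq_toFinset_card _ h.finite_dualPoints]
  set Y := h.finite_dualPoints.toFinset with hY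
  let tri : Finset E → Finset (E × E × E) := fun A => (A ×ˢ A ×ˢ A).filter
    fun p => ⟪p.1, p.2.1⟫ = 2 ∧ ⟪p.1, p.2.2⟫ = 2 ∧ ⟪p.2.1, p.2.2⟫ = 2
  let R : E → E × E × E → Prop := fun y p => ⟪p.1, y⟫ = -6 ∧ ⟪p.2.1, y⟫ = -6 ∧ ⟪p.2.2, y⟫ = -6
  have htri : (tri X).card = 275 * (162 * 105) := by
    rw [← h.card_eq]
    exact card_filter_triples (fun a b : E => ⟪a, b⟫ = 2) X 162 105
      (fun a ha => h.card_filter_inner_eq_two ha)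
      (fun a ha b hb hab => h.card_filter_inner_eq_two_and ha hb hab)
  have hbelow : ∀ p ∈ tri X, (Finset.bipartiteBelow R Y p).card = 8 := by
    rintro ⟨a, b, c⟩ hp
    simp only [tri, Finset.mem_filter, Finset.mem_product] at hp
    exact h.card_filter_dualPoints hp.1.1 hp.1.2.1 hp.1.2.2 hp.2.1 hp.2.2.1 hp.2.2.2
  have habove : ∀ y ∈ Y, (Finset.bipartiteAbove R (tri X) y).card = 22 * (21 * 20) := by
    intro y hy
    rw [hY, Set.Finite.mem_toFinset] at hy
    set S := X.filter fun x => ⟪x, y⟫ = -6 with hS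
    have hcard : S.card = 22 := h.card_filter_inner_eq_neg_six hy.1 hy.2
    have htwo : ∀ a ∈ S, ∀ b ∈ S, (⟪a, b⟫ = 2 ↔ b ≠ a) := by
      intro a ha b hb
      rw [hS, Finset.mem_filter] at ha hb
      exact ⟨fun hab => (h.ne_of_inner_eq_two ha.1 hab).symm, fun hab =>
        h.inner_eq_two_of_inner_eq_neg_six hy.1 hy.2 ha.1 hb.1 ha.2 hb.2 hab.symm⟩
    have heq : Finset.bipartiteAbove R (tri X) y = tri S := by
      ext ⟨a, b, c⟩
      simp only [Finset.mem_bipartiteAbove, tri, R, hS, Finset.mem_filter, Finset.mem_product]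
      tauto
    rw [heq, ← hcard]
    refine card_filter_triples (fun a b : E => ⟪a, b⟫ = 2) S 21 20 (fun a ha => ?_)
      (fun a ha b hb hab => ?_)
    · rw [Finset.filter_congr (htwo a ha), Finset.filter_ne', Finset.card_erase_of_mem ha, hcard]
    · have hne := (htwo a ha b hb).1 hab
      rw [Finset.filter_congr fun c hc => and_congr (htwo a ha c hc) (htwo b hb c hc),
        ← Finset.filter_filter, Finset.filter_ne', Finset.filter_ne',
        Finset.card_erase_of_mem (Finset.mem_erase.2 ⟨hne, hb⟩), Finset.card_erase_of_mem ha, hcard]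
  have hdouble := Finset.card_mul_eq_card_mul R habove hbelow
  rw [htri] at hdouble
  lia

end IsScaledTightDesign
end Counting

section Transfer

lemma isScaledTightDesign_image {X₁ : Finset (EuclideanSpace ℝ (Fin 22))}
    (hX₁ : ∀ x ∈ X₁, ‖x‖ = 1) (hcard : X₁.card = 275)
    (hdesign : ∀ f : MvPolynomial (Fin 22) ℝ, f.totalDegree ≤ 4 →
      sphereAvg 22 1 f = (X₁.card : ℝ)⁻¹ * ∑ x ∈ X₁, eval (x : Fin 22 → ℝ) f) :
    IsScaledTightDesign (X₁.image fun x => Real.sqrt 12 • x) := by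
  have h12 : Real.sqrt 12 ^ 2 = 12 := Real.sq_sqrt (by norm_num)
  have hinj : Function.Injective fun x : EuclideanSpace ℝ (Fin 22) => Real.sqrt 12 • x :=
    smul_right_injective _ (by positivity)
  have hsum : ∀ k ≤ 4, ∀ a : EuclideanSpace ℝ (Fin 22),
      ∑ x ∈ X₁.image fun x => Real.sqrt 12 • x, ⟪x, a⟫ ^ k =
        Real.sqrt 12 ^ k * (275 * sphereMoment 22 k a) := by
    intro k hk a
    rw [Finset.sum_image hinj.injOn]
    simp_rw [real_inner_smul_left, mul_pow]
    rw [← Finset.mul_sum, sum_inner_pow_of_design (by lia) hdesign hk a, hcard]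
    norm_num
  refine isScaledTightDesign_of_powers ?_ ?_ ?_ ?_ ?_ ?_
  · rw [Finset.card_image_of_injective _ hinj, hcard]
  · intro x hx
    obtain ⟨x, hx', rfl⟩ := Finset.mem_image.1 hx
    rw [real_inner_self_eq_norm_sq, norm_smul, hX₁ x hx', mul_one, Real.norm_eq_abs, sq_abs, h12]
  · intro a
    rw [hsum 1 (by norm_num), sphereMoment_odd (by decide)]
    ring
  · intro a
    rw [hsum 2 (by norm_num), sphereMoment_two (by norm_num), h12, real_inner_self_eq_norm_sq]
    push_cast; ring
  · intro a
    rw [hsum 3 (by norm_num), sphereMoment_odd (by decide)]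
    ring
  · intro a
    rw [hsum 4 (by norm_num), sphereMoment_four (by norm_num), real_inner_self_eq_norm_sq,
      show Real.sqrt 12 ^ 4 = (Real.sqrt 12 ^ 2) ^ 2 by ring, h12]
    push_cast; ring

lemma image_smul_eq_dualPoints {n : ℕ} {X₁ : Finset (EuclideanSpace ℝ (Fin n))}
    (h : IsScaledTightDesign (X₁.image fun x => Real.sqrt 12 • x)) :
    (fun y => Real.sqrt (44 / 3) • y) '' {y : EuclideanSpace ℝ (Fin n) | ‖y‖ = 1 ∧
      ∀ x ∈ X₁, ⟪x, y⟫ ∈ ({1 / Real.sqrt 11, -(1 / (4 * Real.sqrt 11)),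
        -(3 / (2 * Real.sqrt 11))} : Set ℝ)} =
      dualPoints (X₁.image fun x => Real.sqrt 12 • x) := by
  have h44 : Real.sqrt (44 / 3) ^ 2 = 44 / 3 := Real.sq_sqrt (by norm_num)
  have h11 : 0 < Real.sqrt 11 := by positivity
  have hprod : Real.sqrt 12 * Real.sqrt (44 / 3) = 4 * Real.sqrt 11 := by
    rw [← Real.sqrt_mul (by norm_num), show (12 * (44 / 3) : ℝ) = 4 ^ 2 * 11 by norm_num,
      Real.sqrt_mul (by norm_num), Real.sqrt_sq (by norm_num)]
  have hval : ∀ t : ℝ, t ∈ ({1 / Real.sqrt 11, -(1 / (4 * Real.sqrt 11)),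
      -(3 / (2 * Real.sqrt 11))} : Set ℝ) ↔ 4 * Real.sqrt 11 * t = 4 ∨
        4 * Real.sqrt 11 * t = -1 ∨ 4 * Real.sqrt 11 * t = -6 := by
    intro t
    simp only [Set.mem_insert_iff, Set.mem_singleton_iff]
    refine or_congr ?_ (or_congr ?_ ?_)
    · rw [eq_div_iff h11.ne']
      constructor <;> intro ht <;> linarith
    · rw [← neg_div, eq_div_iff (by positivity)]
      constructor <;> intro ht <;> linarith
    · rw [← neg_div, eq_div_iff (by positivity)]
      constructor <;> intro ht <;> linarith
  have hinner : ∀ x y : EuclideanSpace ℝ (Fin n),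
      ⟪Real.sqrt 12 • x, Real.sqrt (44 / 3) • y⟫ = 4 * Real.sqrt 11 * ⟪x, y⟫ := fun x y => by
    rw [real_inner_smul_left, real_inner_smul_right, ← mul_assoc, hprod]
  have hnorm : ∀ y : EuclideanSpace ℝ (Fin n),
      ⟪Real.sqrt (44 / 3) • y, Real.sqrt (44 / 3) • y⟫ = 44 / 3 * ‖y‖ ^ 2 := fun y => by
    rw [real_inner_smul_left, real_inner_smul_right, real_inner_self_eq_norm_sq, ← mul_assoc, ← sq,
      h44]
  ext z
  constructor
  · rintro ⟨y, ⟨hy, hX⟩, rfl⟩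
    refine ⟨by simp only [hnorm, hy]; norm_num, fun x hx => ?_⟩
    obtain ⟨x, hx', rfl⟩ := Finset.mem_image.1 hx
    simp only [hinner]
    rcases (hval _).1 (hX x hx') with h1 | h1 | h1 <;> rw [h1]
    · exact ⟨0, by norm_num⟩
    · exact ⟨-1, by norm_num⟩
    · exact ⟨-2, by norm_num⟩
  · intro hz
    obtain ⟨y, rfl⟩ : ∃ y, Real.sqrt (44 / 3) • y = z :=
      ⟨(Real.sqrt (44 / 3))⁻¹ • z, smul_inv_smul₀ (by positivity) z⟩
    refine ⟨y, ⟨?_, fun x hx => ?_⟩, rfl⟩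
    · have := hz.1
      rw [hnorm] at this
      have h1 : ‖y‖ ^ 2 = 1 := by linarith
      exact (pow_eq_one_iff_of_nonneg (norm_nonneg y) two_ne_zero).1 h1
    · rw [hval, ← hinner]
      exact h.inner_eq_of_inner_self_eq' hz.1 hz.2 (Finset.mem_image_of_mem _ hx)

end Transfer

/-- for a tight spherical 4-design `X₁` (275 points) on the unit sphere of
`ℝ²²`, exactly 4050 points `y` of the unit sphere have all inner products with points of
`X₁` in `{1/√11, -1/(4√11), -3/(2√11)}`. -/
theorem statement16 (X₁ : Finset (EuclideanSpace ℝ (Fin 22)))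
    (hX₁ : ∀ x ∈ X₁, ‖x‖ = 1) (hcard : X₁.card = 275)
    (hdesign : ∀ f : MvPolynomial (Fin 22) ℝ, f.totalDegree ≤ 4 →
      sphereAvg 22 1 f = (X₁.card : ℝ)⁻¹ * ∑ x ∈ X₁, eval (x : Fin 22 → ℝ) f) :
    {y : EuclideanSpace ℝ (Fin 22) | ‖y‖ = 1 ∧ ∀ x ∈ X₁, ⟪x, y⟫ ∈
        ({1 / Real.sqrt 11, -(1 / (4 * Real.sqrt 11)), -(3 / (2 * Real.sqrt 11))} :
          Set ℝ)}.ncard = 4050 := by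
  have h := isScaledTightDesign_image hX₁ hcard hdesign
  rw [← h.ncard_dualPoints, ← image_smul_eq_dualPoints h]
  exact (Set.ncard_image_of_injective _ (smul_right_injective _ (by positivity))).symm
end

section
/- Let (X,w) be a Euclidean 2e-design in ℝ^n supported by p concentric spheres centered at the origin, and let S denote the union of these p spheres. Then |X| ≥ dim 𝒫_e(S), where 𝒫_e(S) = { f|_S : f a polynomial on ℝ^n of total degree at most e } is the vector space of restrictions to S of polynomials of degree at most e. -/
open MeasureTheory Metric MvPolynomial
open scoped RealInnerProductSpace Classical

/-- The linear map restricting a polynomial in `n` variables to a subset `S ⊆ ℝⁿ`,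
viewed as the real-valued function `S → ℝ` it induces. -/
noncomputable def evalOnSet (n : ℕ) (S : Set (EuclideanSpace ℝ (Fin n))) :
    MvPolynomial (Fin n) ℝ →ₗ[ℝ] (S → ℝ) where
  toFun f s := eval ((s : EuclideanSpace ℝ (Fin n)) : Fin n → ℝ) f
  map_add' f g := by funext s; simp
  map_smul' c f := by funext s; simp [MvPolynomial.smul_eval]

/-- The average of a square over a sphere centered at the origin is nonnegative. -/
theorem sphereAvg_sq_nonneg (n : ℕ) (r : ℝ) (f : MvPolynomial (Fin n) ℝ) :
    0 ≤ sphereAvg n r (f ^ 2) := by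
  rw [sphereAvg, average_eq]
  refine smul_nonneg (by positivity) (integral_nonneg fun u => ?_)
  simp only [Pi.zero_apply, map_pow]
  positivity

/-- The average of `f ^ 2` over a sphere centered at the origin is positive as soon as `f` does
not vanish somewhere on that sphere. -/
theorem sphereAvg_sq_pos {n : ℕ} {r : ℝ} {f : MvPolynomial (Fin n) ℝ}
    (u : sphere (0 : EuclideanSpace ℝ (Fin n)) 1)
    (hu : eval (fun i => r * (u : EuclideanSpace ℝ (Fin n)) i) f ≠ 0) :
    0 < sphereAvg n r (f ^ 2) := by
  have hcont : Continuous fun u : sphere (0 : EuclideanSpace ℝ (Fin n)) 1 =>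
      eval (fun i => r * (u : EuclideanSpace ℝ (Fin n)) i) (f ^ 2) :=
    (MvPolynomial.continuous_eval (f ^ 2)).comp (by fun_prop)
  have huniv : 0 < ((volume : Measure (EuclideanSpace ℝ (Fin n))).toSphere).real Set.univ :=
    ENNReal.toReal_pos (isOpen_univ.measure_ne_zero _ ⟨u, trivial⟩) (measure_ne_top _ _)
  rw [sphereAvg, average_eq]
  refine smul_pos (inv_pos.2 huniv)
    (hcont.integral_pos_of_hasCompactSupport_nonneg_nonzero
      (HasCompactSupport.of_compactSpace _) (fun v => ?_) (x := u) ?_)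
  · simp only [Pi.zero_apply, map_pow]
    positivity
  · simpa using hu

/-- A polynomial whose square averages to zero over the sphere of radius `r > 0` centered at the
origin vanishes on that sphere. -/
theorem eval_eq_zero_of_sphereAvg_sq_eq_zero {n : ℕ} {r : ℝ} (hr : 0 < r)
    {f : MvPolynomial (Fin n) ℝ} (hf : sphereAvg n r (f ^ 2) = 0)
    {s : EuclideanSpace ℝ (Fin n)} (hs : ‖s‖ = r) : eval (s : Fin n → ℝ) f = 0 := by
  by_contra hne
  have hu : r⁻¹ • s ∈ sphere (0 : EuclideanSpace ℝ (Fin n)) 1 := by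
    simp [norm_smul, hs, abs_of_pos hr, hr.ne']
  refine (sphereAvg_sq_pos (r := r) (f := f) ⟨r⁻¹ • s, hu⟩ ?_).ne' hf
  simpa [hr.ne'] using hne

/-- Möller's bound: a Euclidean `2e`-design `(X, w)` in `ℝⁿ` supported by `p`
concentric spheres `S = S₁ ∪ ⋯ ∪ S_p` centered at the origin satisfies
`|X| ≥ dim 𝒫ₑ(S)`, where `𝒫ₑ(S)` is the space of restrictions to `S` of polynomials of
total degree at most `e`. -/
theorem statement18 {n e p : ℕ} (X : Finset (EuclideanSpace ℝ (Fin n)))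
    (w : EuclideanSpace ℝ (Fin n) → ℝ) (r : Fin p → ℝ)
    (hrinj : Function.Injective r) (hr0 : ∀ i, 0 ≤ r i)
    (hsupp : ∀ x ∈ X, ∃ i, ‖x‖ = r i)
    (hfib : ∀ i, ∃ x ∈ X, ‖x‖ = r i)
    (hw : ∀ x ∈ X, 0 < w x)
    (hdesign : ∀ f : MvPolynomial (Fin n) ℝ, f.totalDegree ≤ 2 * e →
      ∑ i, (∑ x ∈ X.filter fun x => ‖x‖ = r i, w x) * sphereAvg n (r i) f
        = ∑ x ∈ X, w x * eval (x : Fin n → ℝ) f) :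
    Module.finrank ℝ
        ↥((MvPolynomial.restrictTotalDegree (Fin n) ℝ e).map
          (evalOnSet n (⋃ i, sphere (0 : EuclideanSpace ℝ (Fin n)) (r i))))
      ≤ X.card := by
  have hvanish : ∀ f : MvPolynomial (Fin n) ℝ, f.totalDegree ≤ e →
      (∀ x ∈ X, eval (x : Fin n → ℝ) f = 0) →
      ∀ s : EuclideanSpace ℝ (Fin n), ∀ i, ‖s‖ = r i → eval (s : Fin n → ℝ) f = 0 := by
    intro f hf hfX s i hs
    obtain ⟨x, hxX, hx⟩ := hfib i
    rcases (hr0 i).eq_or_lt with h | h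
    · have hs0 : s = 0 := norm_eq_zero.1 (hs.trans h.symm)
      have hx0 : x = 0 := norm_eq_zero.1 (hx.trans h.symm)
      rw [hs0, ← hx0]
      exact hfX x hxX
    · refine eval_eq_zero_of_sphereAvg_sq_eq_zero h ?_ hs
      have hsum := hdesign (f ^ 2)
        ((totalDegree_pow f 2).trans (Nat.mul_le_mul_left 2 hf))
      rw [Finset.sum_eq_zero (s := X) fun x hx => by simp [hfX x hx],
        Finset.sum_eq_zero_iff_of_nonneg fun j _ => mul_nonneg
          (Finset.sum_nonneg fun x hx => (hw x (Finset.mem_filter.1 hx).1).le)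
          (sphereAvg_sq_nonneg n (r j) f)] at hsum
      refine (mul_eq_zero.1 (hsum i (Finset.mem_univ i))).resolve_left (ne_of_gt ?_)
      exact Finset.sum_pos (fun x hx => hw x (Finset.mem_filter.1 hx).1)
        ⟨x, Finset.mem_filter.2 ⟨hxX, hx⟩⟩
  have hXS : ∀ x : X, (x : EuclideanSpace ℝ (Fin n)) ∈
      ⋃ i, sphere (0 : EuclideanSpace ℝ (Fin n)) (r i) := fun x => by
    simpa using hsupp x x.2
  let restrict := (LinearMap.funLeft ℝ ℝ fun x : X =>
    (⟨x, hXS x⟩ : ↥(⋃ i, sphere (0 : EuclideanSpace ℝ (Fin n)) (r i)))).domRestrict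
      ((restrictTotalDegree (Fin n) ℝ e).map
        (evalOnSet n (⋃ i, sphere (0 : EuclideanSpace ℝ (Fin n)) (r i))))
  have hinj : Function.Injective restrict := by
    rw [injective_iff_map_eq_zero]
    rintro ⟨_, f, hf, rfl⟩ h
    ext ⟨s, hs⟩
    obtain ⟨i, hi⟩ := Set.mem_iUnion.1 hs
    exact hvanish f ((mem_restrictTotalDegree _ _ _).1 hf)
      (fun x hx => congrFun h ⟨x, hx⟩) s i (mem_sphere_zero_iff_norm.1 hi)
  simpa using LinearMap.finrank_le_finrank_of_injective hinj
end
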